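/- arXiv:1308.4247 — 4 statements merged into one kernel-verified Lean document; each statement's English description precedes it below -/
import Mathlib

section
/- Let C ⊂ 𝕋² be a smooth curve with nowhere-vanishing curvature. There exist constants c > 0 and λ₀ > 0, depending only on C, such that for every λ ≥ λ₀ and every nonzero real-valued eigenfunction F of the Laplacian on 𝕋² with eigenvalue λ², the restriction L¹ norm satisfies ∫_C |F| ≥ c·‖F‖₂³ / ‖F‖_{L⁴(C)}², where ‖F‖_{L⁴(C)} = (∫_C |F|⁴)^{1/4}. -/
open MeasureTheory Real

noncomputable section

/-- The Euclidean norm of a vector in `ℝ × ℝ`. -/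
def e2 (x : ℝ × ℝ) : ℝ := Real.sqrt (x.1 ^ 2 + x.2 ^ 2)

/-- The integer vector `μ` viewed as a vector in `ℝ × ℝ`. -/
def iv (μ : ℤ × ℤ) : ℝ × ℝ := ((μ.1 : ℝ), (μ.2 : ℝ))

/-- The set of lattice points on the circle of radius `lam`. -/
def Elat (lam : ℝ) : Finset (ℤ × ℤ) := by
  classical
  exact (Finset.Icc (-⌈lam⌉, -⌈lam⌉) (⌈lam⌉, ⌈lam⌉)).filter
    (fun μ => (μ.1 : ℝ) ^ 2 + (μ.2 : ℝ) ^ 2 = lam ^ 2)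

/-- `B_lam`: the maximal number of lattice points on the circle of radius `lam`
lying in an arc of length `√lam`. -/
def Bmax (lam : ℝ) : ℕ := by
  classical
  exact sSup {n : ℕ | ∃ x : ℝ × ℝ, e2 x = lam ∧
    n = ((Elat lam).filter fun ξ => e2 (iv ξ - x) ≤ Real.sqrt lam).card}

/-- The eigenfunction `F(x) = ∑_{μ ∈ E_lam} a_μ e^{i⟨μ,x⟩}` of the Laplacian on the torus
`ℝ²/(2πℤ²)` with eigenvalue `lam²`. -/
def efn (lam : ℝ) (a : ℤ × ℤ → ℂ) (x : ℝ × ℝ) : ℂ :=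
  ∑ μ ∈ Elat lam, a μ *
    Complex.exp (Complex.I * Complex.ofReal ((μ.1 : ℝ) * x.1 + (μ.2 : ℝ) * x.2))

/-- The `L²` norm of `F` over the torus, realized as the square `[0,2π]²`. -/
def l2T (F : ℝ × ℝ → ℂ) : ℝ :=
  Real.sqrt (∫ x in (Set.Icc (0:ℝ) (2 * π)) ×ˢ (Set.Icc (0:ℝ) (2 * π)), ‖F x‖ ^ 2)

lemma succ_pow_le_mul_two_pow (m k : ℕ) : (k + 1) ^ m ≤ m.factorial * 2 ^ m * 2 ^ k := by
  calc (k + 1) ^ m ≤ (k + 1).ascFactorial m := Nat.pow_succ_le_ascFactorial _ _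
    _ = m.factorial * (k + m).choose m := Nat.ascFactorial_eq_factorial_mul_choose _ _
    _ ≤ m.factorial * 2 ^ (k + m) := by gcongr; exact Nat.choose_le_two_pow _ _
    _ = _ := by rw [pow_add]; ring

lemma GaussianInt.natAbs_norm_cast_eq (z : GaussianInt) :
    (z.norm.natAbs : ℤ) = z.re ^ 2 + z.im ^ 2 := by
  rw [GaussianInt.abs_natCast_norm, Zsqrtd.norm_def]; ring

lemma GaussianInt.two_le_natAbs_norm_of_prime {p : GaussianInt} (hp : Prime p) :
    2 ≤ p.norm.natAbs := by
  have h1 : p.norm.natAbs ≠ 1 := fun h => hp.not_isUnit (Zsqrtd.norm_eq_one_iff.1 h)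
  have h0 : p.norm.natAbs ≠ 0 := by
    rw [Int.natAbs_ne_zero]
    exact (GaussianInt.norm_pos.2 hp.ne_zero).ne'
  omega

/-- The Gaussian integers whose coordinates are at most `Q` in absolute value. -/
def gaussianBox (Q : ℕ) : Finset GaussianInt :=
  (Finset.Icc (-(Q : ℤ)) Q ×ˢ Finset.Icc (-(Q : ℤ)) Q).image fun q => ⟨q.1, q.2⟩

lemma mem_gaussianBox {Q : ℕ} {z : GaussianInt} (h : z.norm.natAbs ≤ Q) : z ∈ gaussianBox Q := by
  have h1 := GaussianInt.natAbs_norm_cast_eq z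
  have h2 : (z.norm.natAbs : ℤ) ≤ Q := by exact_mod_cast h
  have aux : ∀ x y : ℤ, x ^ 2 + y ^ 2 ≤ Q → -(Q : ℤ) ≤ x ∧ x ≤ Q := fun x y hxy => by
    constructor <;> nlinarith [sq_nonneg y, sq_nonneg (x - 1), sq_nonneg (x + 1),
      Int.le_self_sq x, Int.le_self_sq (-x)]
  refine Finset.mem_image.2 ⟨(z.re, z.im), ?_, rfl⟩
  simp only [Finset.mem_product, Finset.mem_Icc]
  exact ⟨aux z.re z.im (by linarith), aux z.im z.re (by linarith)⟩

open Classical UniqueFactorizationMonoid in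
/-- A divisor bound in the Gaussian integers, with arbitrarily small exponent `1 / m`. -/
lemma GaussianInt.exists_card_pow_le (m : ℕ) : ∃ C : ℕ, ∀ (n : GaussianInt) (S : Finset GaussianInt),
    n ≠ 0 → (∀ z ∈ S, z ∣ n) → S.card ^ m ≤ C * n.norm.natAbs := by
  let : StrongNormalizationMonoid GaussianInt :=
    UniqueFactorizationMonoid.strongNormalizationMonoid
  set A := m.factorial * 2 ^ m with hA
  have hA1 : 1 ≤ A := Nat.one_le_iff_ne_zero.2 (by positivity)
  refine ⟨(gaussianBox 1).card ^ m * A ^ (gaussianBox (2 ^ m)).card, fun n S hn hS => ?_⟩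
  have hcard : S.card ≤ (gaussianBox 1).card * (Finset.Iic (normalizedFactors n)).card := by
    refine Finset.card_le_mul_card_image_of_maps_to (f := normalizedFactors) (fun z hz => ?_) _
      fun b _ => ?_
    · have hz0 : z ≠ 0 := by rintro rfl; exact hn (zero_dvd_iff.1 (hS _ hz))
      exact Finset.mem_Iic.2 ((dvd_iff_normalizedFactors_le_normalizedFactors hz0 hn).1 (hS z hz))
    · rcases Finset.eq_empty_or_nonempty (S.filter fun z => normalizedFactors z = b) with h | ⟨w, hw⟩
      · rw [h]; simp
      · refine le_trans (Finset.card_le_card ?_)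
          (Finset.card_image_le (s := gaussianBox 1) (f := fun u => w * u))
        intro z hz
        rw [Finset.mem_filter] at hz hw
        have hne : ∀ z ∈ S, z ≠ 0 := by rintro z hz rfl; exact hn (zero_dvd_iff.1 (hS _ hz))
        obtain ⟨u, hu⟩ := (associated_iff_normalizedFactors_eq_normalizedFactors
          (hne _ hw.1) (hne _ hz.1)).2 (hw.2.trans hz.2.symm)
        exact Finset.mem_image.2 ⟨u, mem_gaussianBox (Zsqrtd.norm_eq_one_iff.2 u.isUnit).le, hu⟩
  have hnorm : n.norm.natAbs = ∏ p ∈ (normalizedFactors n).toFinset,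
      p.norm.natAbs ^ (normalizedFactors n).count p := by
    have h1 : (normalizedFactors n).prod.norm.natAbs = n.norm.natAbs :=
      Int.associated_iff_natAbs.1 ((prod_normalizedFactors hn).map
        (Zsqrtd.normMonoidHom (d := -1)))
    rw [← h1, Finset.prod_multiset_count]
    change Int.natAbsHom (Zsqrtd.normMonoidHom (d := -1) _) = _
    simp only [map_prod, map_pow]
    rfl
  have hprod : (∏ p ∈ (normalizedFactors n).toFinset, ((normalizedFactors n).count p + 1)) ^ m ≤
      A ^ (gaussianBox (2 ^ m)).card * n.norm.natAbs := by
    rw [← Finset.prod_pow]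
    calc _ ≤ ∏ p ∈ (normalizedFactors n).toFinset, ((if p ∈ gaussianBox (2 ^ m) then A else 1) *
          p.norm.natAbs ^ (normalizedFactors n).count p) := by
          refine Finset.prod_le_prod' fun p hp => ?_
          have hp2 := two_le_natAbs_norm_of_prime
            (prime_of_normalized_factor p (Multiset.mem_toFinset.1 hp))
          split_ifs with h
          · exact (succ_pow_le_mul_two_pow m _).trans (by gcongr)
          · have hQ : 2 ^ m ≤ p.norm.natAbs := by
              by_contra hlt
              exact h (mem_gaussianBox (by omega))
            rw [one_mul]
            calc _ ≤ (2 ^ (normalizedFactors n).count p) ^ m := by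
                  gcongr; exact Nat.lt_two_pow_self
              _ = (2 ^ m) ^ (normalizedFactors n).count p := by rw [← pow_mul, ← pow_mul, mul_comm]
              _ ≤ _ := by gcongr
      _ = A ^ ((normalizedFactors n).toFinset ∩ gaussianBox (2 ^ m)).card * n.norm.natAbs := by
          rw [Finset.prod_mul_distrib, ← hnorm, Finset.prod_ite_mem, Finset.prod_const]
      _ ≤ _ := by
          gcongr
          exact Finset.inter_subset_right
  rw [Multiset.card_Iic] at hcard
  calc S.card ^ m ≤ _ := Nat.pow_le_pow_left hcard m
    _ ≤ _ := by rw [mul_pow, mul_assoc]; gcongr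

lemma mem_Elat {lam : ℝ} {μ : ℤ × ℤ} (h : μ ∈ Elat lam) :
    (μ.1 : ℝ) ^ 2 + (μ.2 : ℝ) ^ 2 = lam ^ 2 := by
  simp only [Elat, Finset.mem_filter] at h
  exact h.2

/-- The number of lattice points on the circle of radius `lam` is `O(lam ^ (4 / m))`. -/
lemma exists_card_Elat_pow_le (m : ℕ) : ∃ C : ℝ, 0 ≤ C ∧ ∀ lam : ℝ, lam ≠ 0 →
    (Elat lam).Nonempty → ((Elat lam).card : ℝ) ^ m ≤ C * lam ^ 4 := by
  classical
  obtain ⟨C, hC⟩ := GaussianInt.exists_card_pow_le m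
  refine ⟨C, Nat.cast_nonneg C, fun lam hlam ⟨ν, hν⟩ => ?_⟩
  set N : ℤ := ν.1 ^ 2 + ν.2 ^ 2
  have hN : (N : ℝ) = lam ^ 2 := by rw [← mem_Elat hν]; push_cast [N]; rfl
  have hN0 : N ≠ 0 := by
    intro h
    rw [h] at hN
    exact hlam (by simpa using hN.symm)
  have hinj : Function.Injective (fun μ : ℤ × ℤ => (⟨μ.1, μ.2⟩ : GaussianInt)) := by
    rintro ⟨a, b⟩ ⟨c, d⟩ h
    simpa [Zsqrtd.ext_iff] using h
  have key := hC (N : GaussianInt) ((Elat lam).image fun μ => ⟨μ.1, μ.2⟩)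
    (by exact_mod_cast hN0) (by
      intro z hz
      obtain ⟨μ, hμ, rfl⟩ := Finset.mem_image.1 hz
      have h1 : μ.1 ^ 2 + μ.2 ^ 2 = N := by
        have := mem_Elat hμ
        rw [← hN] at this
        exact_mod_cast this
      refine ⟨⟨μ.1, -μ.2⟩, ?_⟩
      rw [← h1]
      ext <;>
        simp only [Zsqrtd.re_intCast, Zsqrtd.im_intCast, Zsqrtd.re_mul, Zsqrtd.im_mul] <;> ring)
  rw [Finset.card_image_of_injective _ hinj, Zsqrtd.norm_intCast] at key
  have h2 : ((N * N).natAbs : ℝ) = lam ^ 4 := by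
    rw [Nat.cast_natAbs, abs_of_nonneg (mul_self_nonneg N)]
    push_cast
    rw [hN]; ring
  rw [← h2]
  exact_mod_cast key

/-- The sides `a, b, c` of a triangle inscribed in a circle of radius `lam` satisfy
`a * b * c = 2 * lam * D`, where `D` is twice the area. -/
lemma sq_dist_mul_of_mem_circle (x y p q r s lam : ℝ) (h0 : x ^ 2 + y ^ 2 = lam ^ 2)
    (h1 : (x + p) ^ 2 + (y + q) ^ 2 = lam ^ 2) (h2 : (x + r) ^ 2 + (y + s) ^ 2 = lam ^ 2) :
    (p ^ 2 + q ^ 2) * (r ^ 2 + s ^ 2) * ((p - r) ^ 2 + (q - s) ^ 2) =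
      4 * lam ^ 2 * (p * s - q * r) ^ 2 := by
  have hP : p ^ 2 + q ^ 2 = -2 * (x * p + y * q) := by linarith
  have hQ : r ^ 2 + s ^ 2 = -2 * (x * r + y * s) := by linarith
  have e : (p ^ 2 + q ^ 2) * (r ^ 2 + s ^ 2) * ((p - r) ^ 2 + (q - s) ^ 2) =
      ((p ^ 2 + q ^ 2) * r - (r ^ 2 + s ^ 2) * p) ^ 2 +
        ((p ^ 2 + q ^ 2) * s - (r ^ 2 + s ^ 2) * q) ^ 2 := by ring
  rw [e, hP, hQ, ← h0]
  ring

/-- A lattice point on a circle of radius `rho ^ 9` has at most one other lattice point of that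
circle at distance less than `rho ^ 3` from it. -/
lemma eq_of_close_of_mem_Elat {rho : ℝ} (hrho : 0 < rho) {μ ν₁ ν₂ : ℤ × ℤ}
    (hμ : μ ∈ Elat (rho ^ 9)) (h₁ : ν₁ ∈ Elat (rho ^ 9)) (h₂ : ν₂ ∈ Elat (rho ^ 9))
    (n₁ : μ ≠ ν₁) (n₂ : μ ≠ ν₂)
    (c₁ : e2 (iv (μ - ν₁)) < rho ^ 3) (c₂ : e2 (iv (μ - ν₂)) < rho ^ 3) : ν₁ = ν₂ := by
  by_contra hne
  obtain ⟨x, y⟩ := μ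
  obtain ⟨a, b⟩ := ν₁
  obtain ⟨c, d⟩ := ν₂
  have k0 := mem_Elat hμ
  have k1 := mem_Elat h₁
  have k2 := mem_Elat h₂
  simp only [e2, iv, Prod.mk_sub_mk] at c₁ c₂ k0 k1 k2
  rw [Real.sqrt_lt' (by positivity)] at c₁ c₂
  push_cast at c₁ c₂
  have key := sq_dist_mul_of_mem_circle (x : ℝ) y (a - x) (b - y) (c - x) (d - y) (rho ^ 9) k0
    (by simpa using k1) (by simpa using k2)
  have pos : ∀ u v : ℤ, ¬ (u = 0 ∧ v = 0) → (0 : ℝ) < (u : ℝ) ^ 2 + (v : ℝ) ^ 2 := by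
    intro u v h
    rcases not_and_or.1 h with h | h
    · have : (u : ℝ) ≠ 0 := by exact_mod_cast h
      positivity
    · have : (v : ℝ) ≠ 0 := by exact_mod_cast h
      positivity
  have p1 := pos (a - x) (b - y) (fun h => n₁ (by ext <;> simp <;> omega))
  have p2 := pos (c - x) (d - y) (fun h => n₂ (by ext <;> simp <;> omega))
  have p3 := pos (a - c) (b - d) (fun h => hne (by ext <;> simp <;> omega))
  push_cast at p1 p2 p3
  have hD : (1 : ℝ) ≤ (((a : ℝ) - x) * (d - y) - (b - y) * (c - x)) ^ 2 := by
    have h1 : ((a - x) * (d - y) - (b - y) * (c - x) : ℤ) ≠ 0 := by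
      intro h
      have h' : (((a : ℝ) - x) * (d - y) - (b - y) * (c - x)) = 0 := by exact_mod_cast h
      rw [h'] at key
      have : 0 < (((a : ℝ) - x) ^ 2 + (b - y) ^ 2) * ((c - x) ^ 2 + (d - y) ^ 2) *
          ((a - x - (c - x)) ^ 2 + (b - y - (d - y)) ^ 2) := by
        have : ((a : ℝ) - x - (c - x)) ^ 2 + (b - y - (d - y)) ^ 2 = (a - c) ^ 2 + (b - d) ^ 2 := by
          ring
        rw [this]
        positivity
      rw [key] at this
      simp at this
    have h2 : 1 ≤ ((a - x) * (d - y) - (b - y) * (c - x) : ℤ) ^ 2 :=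
      Int.add_one_le_iff.2 (sq_pos_of_ne_zero h1)
    exact_mod_cast h2
  have d1 : ((a : ℝ) - x) ^ 2 + (b - y) ^ 2 < rho ^ 6 := by linear_combination c₁
  have d2 : ((c : ℝ) - x) ^ 2 + (d - y) ^ 2 < rho ^ 6 := by linear_combination c₂
  have d3 : ((a : ℝ) - x - (c - x)) ^ 2 + (b - y - (d - y)) ^ 2 < 4 * rho ^ 6 := by
    linear_combination 2 * d1 + 2 * d2 + sq_nonneg ((a : ℝ) - x + (c - x)) +
      sq_nonneg ((b : ℝ) - y + (d - y))
  have hlt : (((a : ℝ) - x) ^ 2 + (b - y) ^ 2) * ((c - x) ^ 2 + (d - y) ^ 2) *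
      ((a - x - (c - x)) ^ 2 + (b - y - (d - y)) ^ 2) < rho ^ 6 * rho ^ 6 * (4 * rho ^ 6) := by
    gcongr
  have : 4 * (rho ^ 9) ^ 2 * 1 ≤ 4 * (rho ^ 9) ^ 2 *
      (((a : ℝ) - x) * (d - y) - (b - y) * (c - x)) ^ 2 := by gcongr
  rw [← key] at this
  linarith [hlt, this, show rho ^ 6 * rho ^ 6 * (4 * rho ^ 6) = 4 * (rho ^ 9) ^ 2 * 1 by ring]

/-- An `L²`-averaged sublevel estimate: if `ψ` and `ψ'` are never simultaneously small, then
`1 / (1 + (r ψ)²)` has integral `O(1 / r)`. -/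
lemma integral_inv_one_add_sq_le {L M k r : ℝ} {ψ ψ₁ ψ₂ : ℝ → ℝ} (hL : 0 ≤ L) (hr : 1 ≤ r)
    (hk : 0 < k) (h₁ : ∀ t, HasDerivAt ψ (ψ₁ t) t) (h₂ : ∀ t, HasDerivAt ψ₁ (ψ₂ t) t)
    (c₂ : Continuous ψ₂)
    (hlow : ∀ t ∈ Set.Icc 0 L, k ≤ M ^ 2 * ψ t ^ 2 + ψ₁ t ^ 2)
    (b₁ : ∀ t ∈ Set.Icc 0 L, |ψ₁ t| ≤ M) (b₂ : ∀ t ∈ Set.Icc 0 L, |ψ₂ t| ≤ M) :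
    ∫ t in (0 : ℝ)..L, 1 / (1 + (r * ψ t) ^ 2) ≤ (M ^ 2 * L + 4 * M + 2 * M * L) / k / r := by
  have cψ : Continuous ψ := continuous_iff_continuousAt.2 fun t => (h₁ t).continuousAt
  have c₁ : Continuous ψ₁ := continuous_iff_continuousAt.2 fun t => (h₂ t).continuousAt
  have hM : 0 ≤ M := (abs_nonneg _).trans (b₁ 0 ⟨le_rfl, hL⟩)
  have hr0 : 0 < r := by linarith
  have hden : ∀ t, 0 < 1 + (r * ψ t) ^ 2 := fun t => by positivity
  have hat : ∀ t, |arctan (r * ψ t) / r| ≤ 2 / r := fun t => by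
    rw [abs_div, abs_of_pos hr0]
    gcongr
    have h := arctan_lt_pi_div_two (r * ψ t)
    have h' := neg_pi_div_two_lt_arctan (r * ψ t)
    have hpi := Real.pi_lt_four
    exact abs_le.2 ⟨by linarith, by linarith⟩
  have cat : Continuous fun t => arctan (r * ψ t) / r := by fun_prop
  have hparts : ∫ t in (0 : ℝ)..L, ψ₁ t * (ψ₁ t / (1 + (r * ψ t) ^ 2)) ≤
      (4 * M + 2 * M * L) / r := by
    rw [intervalIntegral.integral_mul_deriv_eq_deriv_mul (u := ψ₁) (u' := ψ₂)
      (v := fun t => arctan (r * ψ t) / r) (v' := fun t => ψ₁ t / (1 + (r * ψ t) ^ 2))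
      (fun t _ => h₂ t)
      (fun t _ => by
        convert (((h₁ t).const_mul r).arctan).div_const r using 1
        field_simp)
      (c₂.intervalIntegrable _ _)
      ((c₁.div (by fun_prop) fun t => (hden t).ne').intervalIntegrable _ _)]
    have e1 : |ψ₁ L * (arctan (r * ψ L) / r)| ≤ M * (2 / r) := by
      rw [abs_mul]
      exact mul_le_mul (b₁ L ⟨hL, le_rfl⟩) (hat L) (abs_nonneg _) hM
    have e0 : |ψ₁ 0 * (arctan (r * ψ 0) / r)| ≤ M * (2 / r) := by
      rw [abs_mul]
      exact mul_le_mul (b₁ 0 ⟨le_rfl, hL⟩) (hat 0) (abs_nonneg _) hM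
    have e2 : ‖∫ t in (0 : ℝ)..L, ψ₂ t * (arctan (r * ψ t) / r)‖ ≤ M * (2 / r) * |L - 0| := by
      refine intervalIntegral.norm_integral_le_of_norm_le_const fun t ht => ?_
      rw [Set.uIoc_of_le hL] at ht
      rw [Real.norm_eq_abs, abs_mul]
      exact mul_le_mul (b₂ t ⟨ht.1.le, ht.2⟩) (hat t) (abs_nonneg _) hM
    rw [sub_zero, abs_of_nonneg hL, Real.norm_eq_abs] at e2
    have := abs_le.1 e0
    have := abs_le.1 e1
    have := abs_le.1 e2
    have e : (4 * M + 2 * M * L) / r = M * (2 / r) + M * (2 / r) + M * (2 / r) * L := by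
      field_simp; ring
    rw [e]
    linarith
  have hInt : ∀ f : ℝ → ℝ, Continuous f → IntervalIntegrable
      (fun t => f t / (1 + (r * ψ t) ^ 2)) volume 0 L := fun f hf =>
    (hf.div (by fun_prop) fun t => (hden t).ne').intervalIntegrable _ _
  have hmain : k * ∫ t in (0 : ℝ)..L, 1 / (1 + (r * ψ t) ^ 2) ≤
      M ^ 2 / r ^ 2 * L + (4 * M + 2 * M * L) / r := by
    rw [← intervalIntegral.integral_const_mul]
    calc _ ≤ ∫ t in (0 : ℝ)..L, (M ^ 2 / r ^ 2 + ψ₁ t * (ψ₁ t / (1 + (r * ψ t) ^ 2))) := by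
          refine intervalIntegral.integral_mono_on hL ((hInt _ continuous_const).const_mul k)
            (intervalIntegrable_const.add ((hInt _ c₁).continuousOn_mul c₁.continuousOn))
            fun t ht => ?_
          have : k * (1 / (1 + (r * ψ t) ^ 2)) ≤
              (M ^ 2 * ψ t ^ 2 + ψ₁ t ^ 2) / (1 + (r * ψ t) ^ 2) := by
            rw [mul_one_div]
            exact div_le_div_of_nonneg_right (hlow t ht) (hden t).le
          refine this.trans ?_
          rw [add_div, ← mul_div_assoc, ← sq]
          gcongr ?_ + _
          rw [div_le_div_iff₀ (hden t) (by positivity)]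
          nlinarith [sq_nonneg M]
      _ = M ^ 2 / r ^ 2 * L + ∫ t in (0 : ℝ)..L, ψ₁ t * (ψ₁ t / (1 + (r * ψ t) ^ 2)) := by
          rw [intervalIntegral.integral_add intervalIntegrable_const
            ((hInt _ c₁).continuousOn_mul c₁.continuousOn), intervalIntegral.integral_const]
          simp [mul_comm]
      _ ≤ _ := by gcongr
  rw [div_right_comm, le_div_iff₀ hk, mul_comm]
  refine hmain.trans ?_
  have : M ^ 2 / r ^ 2 * L ≤ M ^ 2 * L / r := by
    rw [div_mul_eq_mul_div]
    gcongr
    nlinarith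
  calc _ ≤ M ^ 2 * L / r + (4 * M + 2 * M * L) / r := by gcongr
    _ = _ := by ring

/-- A van der Corput type estimate. -/
lemma norm_integral_exp_le {L M k r R : ℝ} {φ ψ ψ₁ ψ₂ : ℝ → ℝ} (hL : 0 ≤ L) (hr : 1 ≤ r)
    (hR : r ^ 3 ≤ R) (hk : 0 < k) (h₀ : ∀ t, HasDerivAt φ (ψ t) t)
    (h₁ : ∀ t, HasDerivAt ψ (ψ₁ t) t) (h₂ : ∀ t, HasDerivAt ψ₁ (ψ₂ t) t)
    (c₂ : Continuous ψ₂)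
    (hlow : ∀ t ∈ Set.Icc 0 L, k ≤ M ^ 2 * ψ t ^ 2 + ψ₁ t ^ 2)
    (b₁ : ∀ t ∈ Set.Icc 0 L, |ψ₁ t| ≤ M) (b₂ : ∀ t ∈ Set.Icc 0 L, |ψ₂ t| ≤ M) :
    ‖∫ t in (0 : ℝ)..L, Complex.exp (Complex.I * ((R * φ t : ℝ) : ℂ))‖ ≤
      (2 + M * L + (M ^ 2 * L + 4 * M + 2 * M * L) / k) / r := by
  have cφ : Continuous φ := continuous_iff_continuousAt.2 fun t => (h₀ t).continuousAt
  have cψ : Continuous ψ := continuous_iff_continuousAt.2 fun t => (h₁ t).continuousAt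
  have c₁ : Continuous ψ₁ := continuous_iff_continuousAt.2 fun t => (h₂ t).continuousAt
  have hM : 0 ≤ M := (abs_nonneg _).trans (b₁ 0 ⟨le_rfl, hL⟩)
  have hr0 : 0 < r := by linarith
  have hR0 : 0 < R := lt_of_lt_of_le (by positivity) hR
  have hden : ∀ t, 0 < 1 + (r * ψ t) ^ 2 := fun t => by positivity
  set E : ℝ → ℂ := fun t => Complex.exp (Complex.I * ((R * φ t : ℝ) : ℂ)) with hE
  have nE : ∀ t, ‖E t‖ = 1 := fun t => by
    rw [hE]; simp only [mul_comm Complex.I]; exact Complex.norm_exp_ofReal_mul_I _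
  have cE : Continuous E := by fun_prop
  have dE : ∀ t, HasDerivAt (fun t => E t / (Complex.I * R)) (ψ t * E t) t := fun t => by
    have h := ((((h₀ t).const_mul R).ofReal_comp).const_mul Complex.I).cexp.div_const
      (Complex.I * R)
    refine h.congr_deriv ?_
    have : (R : ℂ) ≠ 0 := by exact_mod_cast hR0.ne'
    have := Complex.I_ne_zero
    change E t * _ / _ = _
    push_cast
    field_simp
  set g : ℝ → ℝ := fun t => r ^ 2 * ψ t / (1 + (r * ψ t) ^ 2) with hg
  set g' : ℝ → ℝ := fun t => r ^ 2 * ψ₁ t * (1 - (r * ψ t) ^ 2) / (1 + (r * ψ t) ^ 2) ^ 2 with hg'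
  have dg : ∀ t, HasDerivAt (fun t => (g t : ℂ)) (g' t) t := fun t => by
    have h := ((h₁ t).const_mul (r ^ 2)).div ((((h₁ t).const_mul r).pow 2).const_add 1)
      (hden t).ne'
    refine HasDerivAt.ofReal_comp (h.congr_deriv ?_)
    simp only [hg']
    congr 1
    simp
    ring
  have bg : ∀ t, |g t| ≤ r := fun t => by
    rw [hg, abs_div, abs_of_pos (hden t), div_le_iff₀ (hden t), abs_le]
    constructor <;> nlinarith [sq_nonneg (r * ψ t - 1), sq_nonneg (r * ψ t + 1)]
  have bg' : ∀ t ∈ Set.Icc 0 L, |g' t| ≤ r ^ 2 * M := fun t ht => by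
    rw [hg', abs_div, abs_of_pos (pow_pos (hden t) 2), div_le_iff₀ (pow_pos (hden t) 2), abs_mul,
      abs_mul, abs_of_pos (by positivity : 0 < r ^ 2)]
    gcongr
    · exact b₁ t ht
    · rw [abs_le]
      constructor <;> nlinarith [sq_nonneg (r * ψ t)]
  have cg' : Continuous g' :=
    Continuous.div (by fun_prop) (by fun_prop) fun t => (pow_pos (hden t) 2).ne'
  have cg : Continuous g := Continuous.div (by fun_prop) (by fun_prop) fun t => (hden t).ne'
  have bE : ∀ t, ‖E t / (Complex.I * R)‖ = 1 / R := fun t => by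
    rw [norm_div, nE, norm_mul, Complex.norm_I, one_mul, Complex.norm_real, Real.norm_of_nonneg hR0.le]
  have hparts : ‖∫ t in (0 : ℝ)..L, (g t : ℂ) * (ψ t * E t)‖ ≤ (2 + M * L) / r := by
    rw [intervalIntegral.integral_mul_deriv_eq_deriv_mul (u := fun t => (g t : ℂ))
      (u' := fun t => (g' t : ℂ)) (v := fun t => E t / (Complex.I * R)) (v' := fun t => ψ t * E t)
      (fun t _ => dg t) (fun t _ => dE t)
      ((Complex.continuous_ofReal.comp cg').intervalIntegrable _ _)
      (((Complex.continuous_ofReal.comp cψ).mul cE).intervalIntegrable _ _)]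
    have e : ∀ t, ‖(g t : ℂ) * (E t / (Complex.I * R))‖ ≤ r * (1 / R) := fun t => by
      rw [norm_mul, bE, Complex.norm_real, Real.norm_eq_abs]
      gcongr
      exact bg t
    have e2 : ‖∫ t in (0 : ℝ)..L, (g' t : ℂ) * (E t / (Complex.I * R))‖ ≤
        r ^ 2 * M * (1 / R) * |L - 0| := by
      refine intervalIntegral.norm_integral_le_of_norm_le_const fun t ht => ?_
      rw [Set.uIoc_of_le hL] at ht
      rw [norm_mul, bE, Complex.norm_real, Real.norm_eq_abs]
      gcongr
      exact bg' t ⟨ht.1.le, ht.2⟩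
    rw [sub_zero, abs_of_nonneg hL] at e2
    have hinv : 1 / R ≤ 1 / r ^ 3 := one_div_le_one_div_of_le (by positivity) hR
    calc _ ≤ r * (1 / R) + r * (1 / R) + r ^ 2 * M * (1 / R) * L :=
          (norm_sub_le _ _).trans (add_le_add ((norm_sub_le _ _).trans (add_le_add (e L) (e 0))) e2)
      _ ≤ r * (1 / r ^ 3) + r * (1 / r ^ 3) + r ^ 2 * M * (1 / r ^ 3) * L := by gcongr
      _ = 2 / r ^ 2 + M * L / r := by field_simp; ring
      _ ≤ 2 / r + M * L / r := by
          gcongr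
          nlinarith
      _ = _ := by ring
  have hsplit : ∫ t in (0 : ℝ)..L, E t = (∫ t in (0 : ℝ)..L, (g t : ℂ) * (ψ t * E t)) +
      ∫ t in (0 : ℝ)..L, ((1 / (1 + (r * ψ t) ^ 2) : ℝ) : ℂ) * E t := by
    rw [← intervalIntegral.integral_add]
    · refine intervalIntegral.integral_congr fun t _ => ?_
      have h : g t * ψ t + 1 / (1 + (r * ψ t) ^ 2) = 1 := by
        have := (hden t).ne'
        simp only [hg]
        field_simp
        ring
      calc E t = ((g t * ψ t + 1 / (1 + (r * ψ t) ^ 2) : ℝ) : ℂ) * E t := by rw [h]; simp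
        _ = _ := by push_cast; ring
    · exact ((Complex.continuous_ofReal.comp cg).mul
        ((Complex.continuous_ofReal.comp cψ).mul cE)).intervalIntegrable _ _
    · exact ((Complex.continuous_ofReal.comp (continuous_const.div (by fun_prop)
        fun t => (hden t).ne')).mul cE).intervalIntegrable _ _
  rw [hsplit, add_div]
  refine (norm_add_le _ _).trans (add_le_add hparts (le_trans ?_
    (integral_inv_one_add_sq_le hL hr hk h₁ h₂ c₂ hlow b₁ b₂)))
  refine (intervalIntegral.norm_integral_le_integral_norm hL).trans
    (intervalIntegral.integral_congr fun t _ => ?_).le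
  simp only [norm_mul, nE, mul_one, Complex.norm_real]
  exact Real.norm_of_nonneg (by have := hden t; positivity)

/-- The Fourier transform of the arc length measure of the curve `γ` at the frequency `ξ`. -/
def curveHat (L : ℝ) (γ : ℝ → ℝ × ℝ) (ξ : ℤ × ℤ) : ℂ :=
  ∫ t in (0 : ℝ)..L,
    Complex.exp (Complex.I * Complex.ofReal ((ξ.1 : ℝ) * (γ t).1 + (ξ.2 : ℝ) * (γ t).2))

lemma inner_deriv_deriv_eq_zero {L : ℝ} {x y x₂ y₂ : ℝ → ℝ} (hL : 0 < L)
    (hx : ∀ t, HasDerivAt x (x₂ t) t) (hy : ∀ t, HasDerivAt y (y₂ t) t)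
    (h : ∀ t ∈ Set.Icc 0 L, x t ^ 2 + y t ^ 2 = 1) {t : ℝ} (ht : t ∈ Set.Icc 0 L) :
    x t * x₂ t + y t * y₂ t = 0 := by
  have h1 : HasDerivWithinAt (fun t => x t ^ 2 + y t ^ 2) (2 * (x t * x₂ t + y t * y₂ t))
      (Set.Icc 0 L) t :=
    (((hx t).pow 2).add ((hy t).pow 2)).hasDerivWithinAt.congr_deriv (by simp; ring)
  have h2 : HasDerivWithinAt (fun t => x t ^ 2 + y t ^ 2) 0 (Set.Icc 0 L) t :=
    (hasDerivWithinAt_const t (Set.Icc 0 L) (1 : ℝ)).congr h (h t ht)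
  have := (uniqueDiffOn_Icc hL t ht).eq_deriv _ h1 h2
  linarith

lemma curvature_identity {p q x₁ y₁ x₂ y₂ : ℝ} (h1 : x₁ ^ 2 + y₁ ^ 2 = 1)
    (h2 : x₁ * x₂ + y₁ * y₂ = 0) :
    (p ^ 2 + q ^ 2) * (x₂ ^ 2 + y₂ ^ 2) =
      (x₂ ^ 2 + y₂ ^ 2) * (p * x₁ + q * y₁) ^ 2 + (p * x₂ + q * y₂) ^ 2 := by
  have hx : x₂ = -(x₁ * y₂ - y₁ * x₂) * y₁ := by linear_combination (-x₂) * h1 + x₁ * h2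
  have hy : y₂ = (x₁ * y₂ - y₁ * x₂) * x₁ := by linear_combination (-y₂) * h1 + y₁ * h2
  generalize x₁ * y₂ - y₁ * x₂ = m at hx hy
  subst hx hy
  linear_combination (-m ^ 2 * (p * x₁ + q * y₁) ^ 2) * h1

/-- Coordinates and derivatives of a unit speed curve with curvature bounded below. -/
lemma exists_curve_coords {L Kmin : ℝ} {γ : ℝ → ℝ × ℝ} (hL : 0 < L) (hKmin : 0 < Kmin)
    (hsmooth : ContDiff ℝ (⊤ : ℕ∞) γ)
    (hunit : ∀ t ∈ Set.Icc (0:ℝ) L, e2 (deriv γ t) = 1)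
    (hcurv : ∀ t ∈ Set.Icc (0:ℝ) L, Kmin ≤ e2 (deriv (deriv γ) t)) :
    ∃ x₁ y₁ x₂ y₂ x₃ y₃ : ℝ → ℝ,
      (∀ t, HasDerivAt (fun t => (γ t).1) (x₁ t) t) ∧
      (∀ t, HasDerivAt (fun t => (γ t).2) (y₁ t) t) ∧
      (∀ t, HasDerivAt x₁ (x₂ t) t) ∧ (∀ t, HasDerivAt y₁ (y₂ t) t) ∧
      (∀ t, HasDerivAt x₂ (x₃ t) t) ∧ (∀ t, HasDerivAt y₂ (y₃ t) t) ∧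
      Continuous x₃ ∧ Continuous y₃ ∧
      (∀ t ∈ Set.Icc 0 L, Kmin ^ 2 ≤ x₂ t ^ 2 + y₂ t ^ 2) ∧
      ∀ t ∈ Set.Icc 0 L, ∀ p q : ℝ, (p ^ 2 + q ^ 2) * (x₂ t ^ 2 + y₂ t ^ 2) =
        (x₂ t ^ 2 + y₂ t ^ 2) * (p * x₁ t + q * y₁ t) ^ 2 + (p * x₂ t + q * y₂ t) ^ 2 := by
  obtain ⟨d0, s1⟩ := contDiff_infty_iff_deriv.1 hsmooth
  obtain ⟨d1, s2⟩ := contDiff_infty_iff_deriv.1 s1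
  obtain ⟨d2, s3⟩ := contDiff_infty_iff_deriv.1 s2
  have hfst : ∀ f : ℝ → ℝ × ℝ, Differentiable ℝ f → ∀ t,
      HasDerivAt (fun t => (f t).1) (deriv f t).1 t := fun f hf t =>
    HasFDerivAt.comp_hasDerivAt (l := Prod.fst) (f := f) t hasFDerivAt_fst (hf t).hasDerivAt
  have hsnd : ∀ f : ℝ → ℝ × ℝ, Differentiable ℝ f → ∀ t,
      HasDerivAt (fun t => (f t).2) (deriv f t).2 t := fun f hf t =>
    HasFDerivAt.comp_hasDerivAt (l := Prod.snd) (f := f) t hasFDerivAt_snd (hf t).hasDerivAt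
  have hu : ∀ t ∈ Set.Icc 0 L, (deriv γ t).1 ^ 2 + (deriv γ t).2 ^ 2 = 1 := fun t ht => by
    have := hunit t ht
    rwa [e2, Real.sqrt_eq_one] at this
  refine ⟨fun t => (deriv γ t).1, fun t => (deriv γ t).2, fun t => (deriv (deriv γ) t).1,
    fun t => (deriv (deriv γ) t).2, fun t => (deriv (deriv (deriv γ)) t).1,
    fun t => (deriv (deriv (deriv γ)) t).2, hfst _ d0, hsnd _ d0, hfst _ d1, hsnd _ d1,
    hfst _ d2, hsnd _ d2, s3.continuous.fst, s3.continuous.snd, fun t ht => ?_, fun t ht p q => ?_⟩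
  · have := hcurv t ht
    rwa [e2, Real.le_sqrt' hKmin] at this
  · exact curvature_identity (hu t ht)
      (inner_deriv_deriv_eq_zero hL (hfst _ d1) (hsnd _ d1) hu ht)

lemma exists_norm_curveHat_le {L Kmin : ℝ} {γ : ℝ → ℝ × ℝ} (hL : 0 < L) (hKmin : 0 < Kmin)
    (hsmooth : ContDiff ℝ (⊤ : ℕ∞) γ)
    (hunit : ∀ t ∈ Set.Icc (0:ℝ) L, e2 (deriv γ t) = 1)
    (hcurv : ∀ t ∈ Set.Icc (0:ℝ) L, Kmin ≤ e2 (deriv (deriv γ) t)) :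
    ∃ C : ℝ, 0 ≤ C ∧ ∀ (r : ℝ) (ξ : ℤ × ℤ), 1 ≤ r → r ^ 3 ≤ e2 (iv ξ) → ‖curveHat L γ ξ‖ ≤ C / r := by
  obtain ⟨x₁, y₁, x₂, y₂, x₃, y₃, dx₀, dy₀, dx₁, dy₁, dx₂, dy₂, cx, cy, hk, hid⟩ :=
    exists_curve_coords hL hKmin hsmooth hunit hcurv
  have cx₂ : Continuous x₂ := continuous_iff_continuousAt.2 fun t => (dx₂ t).continuousAt
  have cy₂ : Continuous y₂ := continuous_iff_continuousAt.2 fun t => (dy₂ t).continuousAt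
  obtain ⟨M, hM⟩ := (isCompact_Icc (a := (0 : ℝ)) (b := L)).exists_bound_of_continuousOn
    (f := fun t => |x₂ t| + |y₂ t| + (|x₃ t| + |y₃ t|)) (by fun_prop)
  have hM2 : ∀ t ∈ Set.Icc 0 L, |x₂ t| + |y₂ t| ≤ M ∧ |x₃ t| + |y₃ t| ≤ M := fun t ht => by
    have := (le_abs_self _).trans (hM t ht)
    have h1 := abs_nonneg (x₂ t)
    have h2 := abs_nonneg (y₂ t)
    have h3 := abs_nonneg (x₃ t)
    have h4 := abs_nonneg (y₃ t)
    constructor <;> linarith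
  have hM0 : 0 ≤ M := le_trans (by positivity) (hM2 0 ⟨le_rfl, hL.le⟩).1
  refine ⟨2 + M * L + (M ^ 2 * L + 4 * M + 2 * M * L) / Kmin ^ 2, by positivity,
    fun r ξ hr hξ => ?_⟩
  set R := e2 (iv ξ) with hRdef
  have hR0 : 0 < R := lt_of_lt_of_le (by positivity) hξ
  have hR2 : R ^ 2 = (ξ.1 : ℝ) ^ 2 + (ξ.2 : ℝ) ^ 2 := Real.sq_sqrt (by positivity)
  set p : ℝ := ξ.1 / R with hp
  set q : ℝ := ξ.2 / R with hq
  have hpq : p ^ 2 + q ^ 2 = 1 := by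
    rw [hp, hq, div_pow, div_pow, ← add_div, ← hR2, div_self (by positivity)]
  have hp1 : |p| ≤ 1 := abs_le_one_iff_mul_self_le_one.2 (by nlinarith [sq_nonneg q])
  have hq1 : |q| ≤ 1 := abs_le_one_iff_mul_self_le_one.2 (by nlinarith [sq_nonneg p])
  have hb : ∀ a b : ℝ, |p * a + q * b| ≤ |a| + |b| := fun a b =>
    (abs_add_le _ _).trans (by
      rw [abs_mul, abs_mul]
      exact add_le_add (mul_le_of_le_one_left (abs_nonneg _) hp1)
        (mul_le_of_le_one_left (abs_nonneg _) hq1))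
  have key := norm_integral_exp_le (L := L) (M := M) (k := Kmin ^ 2) (r := r) (R := R)
    (φ := fun t => p * (γ t).1 + q * (γ t).2) (ψ := fun t => p * x₁ t + q * y₁ t)
    (ψ₁ := fun t => p * x₂ t + q * y₂ t) (ψ₂ := fun t => p * x₃ t + q * y₃ t)
    hL.le hr hξ (by positivity)
    (fun t => ((dx₀ t).const_mul p).add ((dy₀ t).const_mul q))
    (fun t => ((dx₁ t).const_mul p).add ((dy₁ t).const_mul q))
    (fun t => ((dx₂ t).const_mul p).add ((dy₂ t).const_mul q))
    (by fun_prop)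
    (fun t ht => by
      have h := hid t ht p q
      rw [hpq, one_mul] at h
      have h' : x₂ t ^ 2 + y₂ t ^ 2 ≤ M ^ 2 := by
        have := pow_le_pow_left₀ (by positivity) (hM2 t ht).1 2
        nlinarith [sq_abs (x₂ t), sq_abs (y₂ t), abs_nonneg (x₂ t), abs_nonneg (y₂ t),
          mul_nonneg (abs_nonneg (x₂ t)) (abs_nonneg (y₂ t))]
      calc _ ≤ _ := hk t ht
        _ = _ := h
        _ ≤ _ := by gcongr)
    (fun t ht => (hb _ _).trans (hM2 t ht).1) (fun t ht => (hb _ _).trans (hM2 t ht).2)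
  refine le_trans (le_of_eq ?_) key
  unfold curveHat
  congr 1
  refine intervalIntegral.integral_congr fun t _ => ?_
  have h1 : R * p = ξ.1 := by rw [hp]; field_simp
  have h2 : R * q = ξ.2 := by rw [hq]; field_simp
  rw [mul_add, ← mul_assoc, ← mul_assoc, h1, h2]

lemma norm_curveHat_lt {L Kmin : ℝ} {γ : ℝ → ℝ × ℝ} (hL : 0 < L) (hKmin : 0 < Kmin)
    (hsmooth : ContDiff ℝ (⊤ : ℕ∞) γ)
    (hunit : ∀ t ∈ Set.Icc (0:ℝ) L, e2 (deriv γ t) = 1)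
    (hcurv : ∀ t ∈ Set.Icc (0:ℝ) L, Kmin ≤ e2 (deriv (deriv γ) t))
    {ξ : ℤ × ℤ} (hξ : ξ ≠ 0) : ‖curveHat L γ ξ‖ < L := by
  obtain ⟨x₁, y₁, x₂, y₂, x₃, y₃, dx₀, dy₀, dx₁, dy₁, dx₂, dy₂, cx, cy, hk, hid⟩ :=
    exists_curve_coords hL hKmin hsmooth hunit hcurv
  set φ : ℝ → ℝ := fun t => (ξ.1 : ℝ) * (γ t).1 + (ξ.2 : ℝ) * (γ t).2
  have dφ : ∀ t, HasDerivAt φ ((ξ.1 : ℝ) * x₁ t + (ξ.2 : ℝ) * y₁ t) t := fun t =>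
    ((dx₀ t).const_mul _).add ((dy₀ t).const_mul _)
  have dφ' : ∀ t, HasDerivAt (fun t => (ξ.1 : ℝ) * x₁ t + (ξ.2 : ℝ) * y₁ t)
      ((ξ.1 : ℝ) * x₂ t + (ξ.2 : ℝ) * y₂ t) t := fun t =>
    ((dx₁ t).const_mul _).add ((dy₁ t).const_mul _)
  set E : ℝ → ℂ := fun t => Complex.exp (Complex.I * (φ t : ℂ))
  have dE : ∀ t, HasDerivAt E
      (E t * (Complex.I * (((ξ.1 : ℝ) * x₁ t + (ξ.2 : ℝ) * y₁ t : ℝ) : ℂ))) t := fun t =>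
    ((dφ t).ofReal_comp.const_mul Complex.I).cexp
  have cE : Continuous E := continuous_iff_continuousAt.2 fun t => (dE t).continuousAt
  have nE : ∀ t, ‖E t‖ = 1 := fun t => by
    simp only [E, mul_comm Complex.I]
    exact Complex.norm_exp_ofReal_mul_I _
  rcases ae_eq_const_or_norm_integral_lt_of_norm_le_const (μ := volume.restrict (Set.Ioo 0 L))
    (f := E) (C := 1) (Filter.Eventually.of_forall fun t => (nE t).le) with h | h
  · exfalso
    set c := ⨍ t in Set.Ioo 0 L, E t
    have hconst : Set.EqOn E (fun _ => c) (Set.Ioo 0 L) :=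
      Measure.eqOn_open_of_ae_eq h isOpen_Ioo cE.continuousOn continuousOn_const
    have hψ : ∀ t ∈ Set.Ioo 0 L, (ξ.1 : ℝ) * x₁ t + (ξ.2 : ℝ) * y₁ t = 0 := fun t ht => by
      have h1 := (hasDerivAt_const t c).congr_of_eventuallyEq
        (hconst.eventuallyEq_of_mem (isOpen_Ioo.mem_nhds ht))
      have h2 := (dE t).unique h1
      have h3 : E t ≠ 0 := Complex.exp_ne_zero _
      simpa [h3, Complex.I_ne_zero, -Complex.ofReal_add, -Complex.ofReal_mul] using h2
    have ht : L / 2 ∈ Set.Ioo 0 L := ⟨by linarith, by linarith⟩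
    have hψ' : (ξ.1 : ℝ) * x₂ (L / 2) + (ξ.2 : ℝ) * y₂ (L / 2) = 0 := by
      have hEq : Set.EqOn (fun t => (ξ.1 : ℝ) * x₁ t + (ξ.2 : ℝ) * y₁ t) (fun _ => 0)
        (Set.Ioo 0 L) := hψ
      exact (dφ' _).unique ((hasDerivAt_const _ (0 : ℝ)).congr_of_eventuallyEq
        (hEq.eventuallyEq_of_mem (isOpen_Ioo.mem_nhds ht)))
    have h1 := hid _ (Set.Ioo_subset_Icc_self ht) ξ.1 ξ.2
    have h2 := hk _ (Set.Ioo_subset_Icc_self ht)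
    rw [hψ _ ht, hψ'] at h1
    have h3 : (0 : ℝ) < (ξ.1 : ℝ) ^ 2 + (ξ.2 : ℝ) ^ 2 := by
      rcases ξ with ⟨a, b⟩
      by_contra hle
      have ha : (a : ℝ) = 0 := by nlinarith [sq_nonneg (a : ℝ), sq_nonneg (b : ℝ)]
      have hb : (b : ℝ) = 0 := by nlinarith [sq_nonneg (a : ℝ), sq_nonneg (b : ℝ)]
      exact hξ (by ext <;> simp <;> [exact_mod_cast ha; exact_mod_cast hb])
    have h4 : 0 < x₂ (L / 2) ^ 2 + y₂ (L / 2) ^ 2 := lt_of_lt_of_le (by positivity) h2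
    have := mul_pos h3 h4
    rw [h1] at this
    simp at this
  · unfold curveHat
    rw [intervalIntegral.integral_of_le hL.le, integral_Ioc_eq_integral_Ioo]
    have h' : ‖∫ t in Set.Ioo 0 L, E t‖ < L := by simpa [measureReal_def, hL.le] using h
    exact h'

/-- Non-trivial Fourier coefficients of a curved arc are uniformly smaller than its length. -/
lemma exists_norm_curveHat_le_sub {L Kmin : ℝ} {γ : ℝ → ℝ × ℝ} (hL : 0 < L) (hKmin : 0 < Kmin)
    (hsmooth : ContDiff ℝ (⊤ : ℕ∞) γ)
    (hunit : ∀ t ∈ Set.Icc (0:ℝ) L, e2 (deriv γ t) = 1)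
    (hcurv : ∀ t ∈ Set.Icc (0:ℝ) L, Kmin ≤ e2 (deriv (deriv γ) t)) :
    ∃ η > (0 : ℝ), ∀ ξ : ℤ × ℤ, ξ ≠ 0 → ‖curveHat L γ ξ‖ ≤ L - η := by
  obtain ⟨C, hC0, hC⟩ := exists_norm_curveHat_le hL hKmin hsmooth hunit hcurv
  set r := 1 + 2 * C / L with hr
  have hr1 : 1 ≤ r := by rw [hr]; linarith [show 0 ≤ 2 * C / L by positivity]
  have hCr : C / r ≤ L / 2 := by
    rw [div_le_div_iff₀ (by positivity) (by positivity), hr, mul_add, mul_div_cancel₀ _ hL.ne']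
    linarith
  set B : ℤ := ⌈r ^ 3⌉
  set s := (Finset.Icc (-B, -B) (B, B)).filter fun ξ : ℤ × ℤ => ξ ≠ 0
  have hs : ∀ᶠ η in nhdsWithin (0 : ℝ) (Set.Ioi 0), ∀ ξ ∈ s, ‖curveHat L γ ξ‖ ≤ L - η := by
    refine (Filter.eventually_all_finset s).2 fun ξ hξ => nhdsWithin_le_nhds ?_
    have := norm_curveHat_lt hL hKmin hsmooth hunit hcurv (Finset.mem_filter.1 hξ).2
    filter_upwards [gt_mem_nhds (sub_pos.2 this)] with η hη
    linarith
  have hL2 : ∀ᶠ η in nhdsWithin (0 : ℝ) (Set.Ioi 0), η < L / 2 :=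
    nhdsWithin_le_nhds (gt_mem_nhds (by positivity))
  obtain ⟨η, h1, h2, h3⟩ := (hs.and (hL2.and self_mem_nhdsWithin)).exists
  refine ⟨η, h3, fun ξ hξ => ?_⟩
  rcases le_or_gt (r ^ 3) (e2 (iv ξ)) with h | h
  · linarith [hC r ξ hr1 h]
  · refine h1 ξ (Finset.mem_filter.2 ⟨?_, hξ⟩)
    have hB := Int.le_ceil (r ^ 3)
    have hx : |(ξ.1 : ℝ)| ≤ e2 (iv ξ) := Real.abs_le_sqrt (by simp [iv]; positivity)
    have hy : |(ξ.2 : ℝ)| ≤ e2 (iv ξ) := Real.abs_le_sqrt (by simp [iv]; positivity)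
    have ax : |ξ.1| ≤ B := by exact_mod_cast (hx.trans h.le).trans hB
    have ay : |ξ.2| ≤ B := by exact_mod_cast (hy.trans h.le).trans hB
    rw [abs_le] at ax ay
    exact Finset.mem_Icc.2 ⟨⟨ax.1, ay.1⟩, ⟨ax.2, ay.2⟩⟩

/-- The character of frequency `μ` on the plane. -/
def planeChar (μ : ℤ × ℤ) (x : ℝ × ℝ) : ℂ :=
  Complex.exp (Complex.I * Complex.ofReal ((μ.1 : ℝ) * x.1 + (μ.2 : ℝ) * x.2))

@[fun_prop]
lemma continuous_planeChar (μ : ℤ × ℤ) : Continuous (planeChar μ) := by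
  unfold planeChar
  fun_prop

lemma norm_planeChar (μ : ℤ × ℤ) (x : ℝ × ℝ) : ‖planeChar μ x‖ = 1 := by
  rw [planeChar, mul_comm Complex.I]
  exact Complex.norm_exp_ofReal_mul_I _

lemma planeChar_zero (x : ℝ × ℝ) : planeChar 0 x = 1 := by simp [planeChar]

lemma planeChar_neg (μ : ℤ × ℤ) (x : ℝ × ℝ) :
    planeChar (-μ) x = starRingEnd ℂ (planeChar μ x) := by
  rw [planeChar, planeChar, ← Complex.exp_conj]
  simp
  ring_nf

lemma planeChar_mul_conj (μ ν : ℤ × ℤ) (x : ℝ × ℝ) :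
    planeChar μ x * starRingEnd ℂ (planeChar ν x) = planeChar (μ - ν) x := by
  rw [← planeChar_neg, planeChar, planeChar, planeChar, ← Complex.exp_add]
  congr 1
  simp
  ring

lemma continuous_efn (lam : ℝ) (a : ℤ × ℤ → ℂ) : Continuous (efn lam a) := by
  unfold efn
  fun_prop

lemma integral_norm_efn_sq {X : Type*} [MeasurableSpace X] (P : Measure X) [IsFiniteMeasure P]
    (g : X → ℝ × ℝ) (hg : Measurable g) (lam : ℝ) (a : ℤ × ℤ → ℂ) :
    ((∫ x, ‖efn lam a (g x)‖ ^ 2 ∂P : ℝ) : ℂ) = ∑ μ ∈ Elat lam, ∑ ν ∈ Elat lam,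
      a μ * starRingEnd ℂ (a ν) * ∫ x, planeChar (μ - ν) (g x) ∂P := by
  have hInt : ∀ ξ, Integrable (fun x => planeChar ξ (g x)) P := fun ξ =>
    Integrable.of_bound ((continuous_planeChar ξ).measurable.comp hg).aestronglyMeasurable 1
      (Filter.Eventually.of_forall fun x => (norm_planeChar _ _).le)
  have hpt : ∀ x, ((‖efn lam a (g x)‖ ^ 2 : ℝ) : ℂ) = ∑ μ ∈ Elat lam, ∑ ν ∈ Elat lam,
      a μ * starRingEnd ℂ (a ν) * planeChar (μ - ν) (g x) := fun x => by
    push_cast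
    rw [← Complex.mul_conj', show efn lam a (g x) = ∑ μ ∈ Elat lam, a μ * planeChar μ (g x) from rfl,
      map_sum, Finset.sum_mul_sum]
    refine Finset.sum_congr rfl fun μ _ => Finset.sum_congr rfl fun ν _ => ?_
    rw [← planeChar_mul_conj, map_mul]
    ring
  rw [← integral_complex_ofReal]
  simp_rw [hpt]
  rw [integral_finsetSum _ fun μ _ => integrable_finsetSum _ fun ν _ => (hInt _).const_mul _]
  refine Finset.sum_congr rfl fun μ _ => ?_
  rw [integral_finsetSum _ fun ν _ => (hInt _).const_mul _]
  simp_rw [integral_const_mul]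

lemma integral_exp_int_eq_zero {k : ℤ} (hk : k ≠ 0) :
    ∫ t in Set.Icc (0 : ℝ) (2 * π), Complex.exp (Complex.I * ((k * t : ℝ) : ℂ)) = 0 := by
  rw [integral_Icc_eq_integral_Ioc, ← intervalIntegral.integral_of_le (by positivity)]
  have hc : Complex.I * (k : ℂ) ≠ 0 := mul_ne_zero Complex.I_ne_zero (by exact_mod_cast hk)
  have h := integral_exp_mul_complex (a := 0) (b := 2 * π) hc
  have e : Complex.I * (k : ℂ) * ((2 * π : ℝ) : ℂ) = k * (2 * π * Complex.I) := by push_cast; ring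
  rw [e, Complex.exp_int_mul_two_pi_mul_I] at h
  simp only [Complex.ofReal_zero, mul_zero, Complex.exp_zero, sub_self, zero_div] at h
  rw [← h]
  refine intervalIntegral.integral_congr fun t _ => ?_
  push_cast
  ring_nf

lemma integral_planeChar_square {ξ : ℤ × ℤ} (hξ : ξ ≠ 0) :
    ∫ x in (Set.Icc (0:ℝ) (2 * π)) ×ˢ (Set.Icc (0:ℝ) (2 * π)), planeChar ξ x = 0 := by
  have h : ∀ x : ℝ × ℝ, planeChar ξ x = Complex.exp (Complex.I * ((ξ.1 * x.1 : ℝ) : ℂ)) *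
      Complex.exp (Complex.I * ((ξ.2 * x.2 : ℝ) : ℂ)) := fun x => by
    rw [planeChar, ← Complex.exp_add]
    push_cast
    ring_nf
  simp_rw [h]
  rw [Measure.volume_eq_prod, setIntegral_prod_mul
    (fun s : ℝ => Complex.exp (Complex.I * ((ξ.1 * s : ℝ) : ℂ)))
    (fun s : ℝ => Complex.exp (Complex.I * ((ξ.2 * s : ℝ) : ℂ)))]
  by_cases h1 : ξ.1 = 0
  · have h2 : ξ.2 ≠ 0 := fun h2 => hξ (Prod.ext h1 h2)
    rw [integral_exp_int_eq_zero h2, mul_zero]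
  · rw [integral_exp_int_eq_zero h1, zero_mul]

/-- Parseval's identity on the torus. -/
lemma l2T_efn_sq (lam : ℝ) (a : ℤ × ℤ → ℂ) :
    l2T (efn lam a) ^ 2 = (2 * π) ^ 2 * ∑ μ ∈ Elat lam, ‖a μ‖ ^ 2 := by
  rw [l2T, Real.sq_sqrt (integral_nonneg fun x => by positivity)]
  set Q := (Set.Icc (0:ℝ) (2 * π)) ×ˢ (Set.Icc (0:ℝ) (2 * π))
  have hQc : IsCompact Q := isCompact_Icc.prod isCompact_Icc
  have hQ : volume.real Q = (2 * π) ^ 2 := by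
    rw [measureReal_def, Measure.volume_eq_prod, Measure.prod_prod, Real.volume_Icc,
      ENNReal.toReal_mul, ENNReal.toReal_ofReal (by linarith [Real.pi_pos])]
    ring
  have : IsFiniteMeasure (volume.restrict Q) := ⟨by
    rw [Measure.restrict_apply_univ]; exact hQc.measure_lt_top⟩
  have h := integral_norm_efn_sq (volume.restrict Q) id measurable_id lam a
  simp only [id] at h
  have h2 : ∀ μ ∈ Elat lam, ∑ ν ∈ Elat lam, a μ * starRingEnd ℂ (a ν) *
      ∫ x in Q, planeChar (μ - ν) x = (((2 * π) ^ 2 * ‖a μ‖ ^ 2 : ℝ) : ℂ) := fun μ hμ => by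
    rw [Finset.sum_eq_single_of_mem μ hμ]
    · simp only [sub_self, planeChar_zero, Complex.mul_conj']
      rw [setIntegral_const, hQ]
      simp
      ring
    · intro ν _ hν
      rw [integral_planeChar_square (sub_ne_zero.2 hν.symm), mul_zero]
  rw [Finset.sum_congr rfl h2, ← Complex.ofReal_sum, ← Finset.mul_sum] at h
  exact_mod_cast h

/-- A Schur test lower bound for a nearly diagonal Hermitian form. -/
lemma schur_lower_bound {ι : Type*} [DecidableEq ι] (s : Finset ι) (a : ι → ℂ) (K : ι → ι → ℂ)
    (L δ I : ℝ) (hdiag : ∀ μ ∈ s, K μ μ = L) (hsymm : ∀ μ ν, ‖K μ ν‖ = ‖K ν μ‖)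
    (hrow : ∀ μ ∈ s, ∑ ν ∈ s.erase μ, ‖K μ ν‖ ≤ L - δ)
    (hI : (I : ℂ) = ∑ μ ∈ s, ∑ ν ∈ s, a μ * starRingEnd ℂ (a ν) * K μ ν) :
    δ * ∑ μ ∈ s, ‖a μ‖ ^ 2 ≤ I := by
  have h1 : I = ∑ μ ∈ s, (L * ‖a μ‖ ^ 2 +
      ∑ ν ∈ s.erase μ, (a μ * starRingEnd ℂ (a ν) * K μ ν).re) := by
    have := congrArg Complex.re hI
    rw [Complex.ofReal_re, Complex.re_sum] at this
    rw [this]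
    refine Finset.sum_congr rfl fun μ hμ => ?_
    rw [Complex.re_sum, ← Finset.add_sum_erase _ _ hμ, hdiag μ hμ, Complex.mul_conj']
    congr 1
    rw [← Complex.ofReal_pow, ← Complex.ofReal_mul, Complex.ofReal_re, mul_comm]
  have hpt : ∀ μ ν, -(‖a μ‖ ^ 2 * ‖K μ ν‖ / 2 + ‖a ν‖ ^ 2 * ‖K ν μ‖ / 2) ≤
      (a μ * starRingEnd ℂ (a ν) * K μ ν).re := fun μ ν => by
    have h := (abs_le.1 (Complex.abs_re_le_norm (a μ * starRingEnd ℂ (a ν) * K μ ν))).1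
    rw [norm_mul, norm_mul, Complex.norm_conj] at h
    rw [hsymm ν μ]
    nlinarith [mul_nonneg (sq_nonneg (‖a μ‖ - ‖a ν‖)) (norm_nonneg (K μ ν))]
  have hswap : ∑ μ ∈ s, ∑ ν ∈ s.erase μ, ‖a ν‖ ^ 2 * ‖K ν μ‖ / 2 =
      ∑ μ ∈ s, ∑ ν ∈ s.erase μ, ‖a μ‖ ^ 2 * ‖K μ ν‖ / 2 := by
    refine Finset.sum_comm' fun μ ν => ?_
    simp only [Finset.mem_erase]
    tauto
  have hrow' : ∑ μ ∈ s, ∑ ν ∈ s.erase μ, ‖a μ‖ ^ 2 * ‖K μ ν‖ / 2 ≤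
      ∑ μ ∈ s, ‖a μ‖ ^ 2 * (L - δ) / 2 := by
    refine Finset.sum_le_sum fun μ hμ => ?_
    rw [← Finset.sum_div, ← Finset.mul_sum]
    gcongr
    exact hrow μ hμ
  have h2 : ∑ μ ∈ s, (L * ‖a μ‖ ^ 2 + ∑ ν ∈ s.erase μ,
      -(‖a μ‖ ^ 2 * ‖K μ ν‖ / 2 + ‖a ν‖ ^ 2 * ‖K ν μ‖ / 2)) ≤ I := by
    rw [h1]
    exact Finset.sum_le_sum fun μ _ => add_le_add_right (Finset.sum_le_sum fun ν _ => hpt μ ν) _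
  refine le_trans ?_ h2
  simp only [Finset.sum_add_distrib, Finset.sum_neg_distrib]
  rw [hswap]
  rw [← Finset.sum_div, ← Finset.sum_mul] at hrow'
  rw [← Finset.mul_sum]
  linarith

/-- Interpolation of `L²` between `L¹` and `L⁴`. -/
lemma integral_sq_pow_three_le {L : ℝ} (hL : 0 ≤ L) {h : ℝ → ℝ} (hc : Continuous h)
    (h0 : ∀ t, 0 ≤ h t) :
    (∫ t in (0 : ℝ)..L, h t ^ 2) ^ 3 ≤
      (∫ t in (0 : ℝ)..L, h t) ^ 2 * ∫ t in (0 : ℝ)..L, h t ^ 4 := by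
  set A := ∫ t in (0 : ℝ)..L, h t
  set B := ∫ t in (0 : ℝ)..L, h t ^ 2
  set D := ∫ t in (0 : ℝ)..L, h t ^ 4
  have hA : 0 ≤ A := intervalIntegral.integral_nonneg hL fun t _ => h0 t
  have hB : 0 ≤ B := intervalIntegral.integral_nonneg hL fun t _ => by positivity
  have hD : 0 ≤ D := intervalIntegral.integral_nonneg hL fun t _ => by positivity
  have hs : ∀ s : ℝ, 0 < s → 3 * s ^ 2 * B ≤ 2 * s ^ 3 * A + D := fun s hs => by
    have e : ∫ t in (0 : ℝ)..L, (2 * s ^ 3 * h t + h t ^ 4) = 2 * s ^ 3 * A + D := by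
      rw [intervalIntegral.integral_add (by apply Continuous.intervalIntegrable; fun_prop)
        (by apply Continuous.intervalIntegrable; fun_prop), intervalIntegral.integral_const_mul]
    rw [← e, ← intervalIntegral.integral_const_mul]
    refine intervalIntegral.integral_mono_on hL
      (by apply Continuous.intervalIntegrable; fun_prop)
      (by apply Continuous.intervalIntegrable; fun_prop) fun t _ => ?_
    have := h0 t
    have : 0 ≤ h t * ((h t - s) ^ 2 * (h t + 2 * s)) := by positivity
    nlinarith
  rcases hB.eq_or_lt with hB0 | hB0
  · have : 0 ≤ A ^ 2 * D := by positivity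
    simpa [← hB0] using this
  · have hA0 : 0 < A := by
      rcases hA.eq_or_lt with hA0 | hA0
      · have h1 := hs (1 + D / B) (by positivity)
        rw [← hA0] at h1
        have h2 : D / B * B = D := div_mul_cancel₀ _ hB0.ne'
        have h3 : 0 ≤ D / B := by positivity
        nlinarith [mul_nonneg h3 hB, mul_nonneg (mul_nonneg h3 h3) hB]
      · exact hA0
    have h1 := hs (B / A) (by positivity)
    have e1 : 3 * (B / A) ^ 2 * B = 3 * B ^ 3 / A ^ 2 := by field_simp
    have e2 : 2 * (B / A) ^ 3 * A = 2 * B ^ 3 / A ^ 2 := by field_simp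
    rw [e1, e2, div_add' _ _ _ (by positivity), div_le_div_iff_of_pos_right (by positivity)] at h1
    linarith

/-- The restriction lower bound `∫_C |F|² ≥ c ‖F‖₂²` in terms of the coefficients of `F`. -/
lemma exists_restriction_L2_lower_bound {L Kmin : ℝ} {γ : ℝ → ℝ × ℝ} (hL : 0 < L)
    (hKmin : 0 < Kmin) (hsmooth : ContDiff ℝ (⊤ : ℕ∞) γ)
    (hunit : ∀ t ∈ Set.Icc (0:ℝ) L, e2 (deriv γ t) = 1)
    (hcurv : ∀ t ∈ Set.Icc (0:ℝ) L, Kmin ≤ e2 (deriv (deriv γ) t)) :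
    ∃ δ > (0 : ℝ), ∃ lam0 > (0 : ℝ), ∀ lam : ℝ, lam0 ≤ lam → ∀ a : ℤ × ℤ → ℂ,
      δ * ∑ μ ∈ Elat lam, ‖a μ‖ ^ 2 ≤ ∫ t in (0:ℝ)..L, ‖efn lam a (γ t)‖ ^ 2 := by
  classical
  obtain ⟨C, hC0, hC⟩ := exists_norm_curveHat_le hL hKmin hsmooth hunit hcurv
  obtain ⟨η, hη, hgap⟩ := exists_norm_curveHat_le_sub hL hKmin hsmooth hunit hcurv
  obtain ⟨C', hC0', hcard⟩ := exists_card_Elat_pow_le 37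
  have hLη : 0 ≤ L - η := (norm_nonneg _).trans (hgap (1, 0) (by simp))
  set rho0 : ℝ := 1 + (2 * C) ^ 37 * C' / η ^ 37 with hrho0
  have hrho01 : 1 ≤ rho0 := by
    rw [hrho0]; linarith [show 0 ≤ (2 * C) ^ 37 * C' / η ^ 37 by positivity]
  refine ⟨η / 2, by positivity, rho0 ^ 9, by positivity, fun lam hlam a => ?_⟩
  obtain ⟨rho, hrho, rfl⟩ : ∃ rho : ℝ, rho0 ≤ rho ∧ rho ^ 9 = lam := by
    have hlam0 : 0 ≤ lam := le_trans (by positivity) hlam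
    have e : (lam ^ ((9 : ℕ)⁻¹ : ℝ)) ^ 9 = lam := Real.rpow_inv_natCast_pow hlam0 (by norm_num)
    refine ⟨_, le_of_not_gt fun h => ?_, e⟩
    have := pow_lt_pow_left₀ h (by positivity) (by norm_num : 9 ≠ 0)
    rw [e] at this
    linarith
  have hrho1 : 1 ≤ rho := hrho01.trans hrho
  have hrhop : 0 < rho := by linarith
  set s := Elat (rho ^ 9)
  have hsmall : (s.card : ℝ) * (C / rho) ≤ η / 2 := by
    rcases s.eq_empty_or_nonempty with hs | hs
    · rw [hs]; simp; positivity
    have hN := hcard (rho ^ 9) (by positivity) hs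
    rw [← mul_div_assoc, div_le_div_iff₀ hrhop two_pos]
    by_contra! hlt
    have h1 : (η * rho) ^ 37 < (s.card * C * 2) ^ 37 :=
      pow_lt_pow_left₀ hlt (by positivity) (by norm_num)
    have h2 : (s.card * C * 2) ^ 37 ≤ (2 * C) ^ 37 * (C' * (rho ^ 9) ^ 4) := by
      rw [show (s.card * C * 2 : ℝ) = 2 * C * s.card by ring, mul_pow]
      gcongr
    have h3 : (2 * C) ^ 37 * C' < η ^ 37 * rho := by
      have : (2 * C) ^ 37 * C' / η ^ 37 < rho := by linarith
      rw [div_lt_iff₀ (by positivity)] at this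
      linarith
    have h4 : (2 * C) ^ 37 * C' * rho ^ 36 < η ^ 37 * rho * rho ^ 36 := by gcongr
    have e1 : (η * rho) ^ 37 = η ^ 37 * rho * rho ^ 36 := by rw [mul_pow, pow_succ rho 36]; ring
    have e2 : (2 * C) ^ 37 * (C' * (rho ^ 9) ^ 4) = (2 * C) ^ 37 * C' * rho ^ 36 := by
      rw [← pow_mul, mul_assoc]
    rw [e1] at h1
    rw [e2] at h2
    linarith
  have hI := integral_norm_efn_sq (volume.restrict (Set.Ioc 0 L)) γ
    hsmooth.continuous.measurable (rho ^ 9) a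
  have hhat : ∀ ξ, curveHat L γ ξ = ∫ t in Set.Ioc 0 L, planeChar ξ (γ t) := fun ξ =>
    intervalIntegral.integral_of_le hL.le
  simp_rw [← hhat] at hI
  rw [← intervalIntegral.integral_of_le hL.le] at hI
  refine schur_lower_bound s a (fun μ ν => curveHat L γ (μ - ν)) L (η / 2) _ (fun μ _ => ?_)
    (fun μ ν => ?_) (fun μ hμ => ?_) hI
  · rw [hhat, sub_self]
    simp [planeChar_zero, measureReal_def, hL.le]
  · rw [hhat, hhat, ← neg_sub ν μ]
    simp_rw [planeChar_neg]
    rw [integral_conj, Complex.norm_conj]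
  · rw [← Finset.sum_filter_add_sum_filter_not _ fun ν => e2 (iv (μ - ν)) < rho ^ 3]
    have hnear : ∑ ν ∈ s.erase μ with e2 (iv (μ - ν)) < rho ^ 3, ‖curveHat L γ (μ - ν)‖ ≤
        L - η := by
      refine (Finset.sum_le_card_nsmul _ _ (L - η) fun ν hν => ?_).trans ?_
      · rw [Finset.mem_filter, Finset.mem_erase] at hν
        exact hgap _ (sub_ne_zero.2 hν.1.1.symm)
      · have h1 : (Finset.filter (fun ν => e2 (iv (μ - ν)) < rho ^ 3) (s.erase μ)).card ≤ 1 := by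
          refine Finset.card_le_one.2 fun ν₁ h₁ ν₂ h₂ => ?_
          rw [Finset.mem_filter, Finset.mem_erase] at h₁ h₂
          exact eq_of_close_of_mem_Elat hrhop hμ h₁.1.2 h₂.1.2 h₁.1.1.symm h₂.1.1.symm h₁.2 h₂.2
        rw [nsmul_eq_mul]
        exact mul_le_of_le_one_left hLη (by exact_mod_cast h1)
    have hfar : ∑ ν ∈ s.erase μ with ¬ e2 (iv (μ - ν)) < rho ^ 3, ‖curveHat L γ (μ - ν)‖ ≤
        s.card * (C / rho) := by
      refine (Finset.sum_le_card_nsmul _ _ (C / rho) fun ν hν => ?_).trans ?_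
      · exact hC rho _ hrho1 (not_lt.1 (Finset.mem_filter.1 hν).2)
      · rw [nsmul_eq_mul]
        gcongr
        exact (Finset.filter_subset _ _).trans (Finset.erase_subset _ _)
    linarith

/-- For a smooth curve with nowhere-zero curvature, the restriction `L¹` norm satisfies
`∫_C |F| ≫ ‖F‖₂³ / ‖F‖_{L⁴(C)}²`, where `‖F‖_{L⁴(C)}² = √(∫_C |F|⁴)`. -/
theorem restriction_L1_lower_bound_via_L4
    (L Kmin Kmax : ℝ) (γ : ℝ → ℝ × ℝ)
    (hL : 0 < L) (hKmin : 0 < Kmin)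
    (hsmooth : ContDiff ℝ (⊤ : ℕ∞) γ)
    (hunit : ∀ t ∈ Set.Icc (0:ℝ) L, e2 (deriv γ t) = 1)
    (hcurv : ∀ t ∈ Set.Icc (0:ℝ) L,
      Kmin ≤ e2 (deriv (deriv γ) t) ∧ e2 (deriv (deriv γ) t) ≤ Kmax) :
    ∃ c > (0:ℝ), ∃ lam0 > (0:ℝ), ∀ lam : ℝ, lam0 ≤ lam →
      ∀ a : ℤ × ℤ → ℂ,
        (∀ μ : ℤ × ℤ, a (-μ) = starRingEnd ℂ (a μ)) →
        (∃ μ ∈ Elat lam, a μ ≠ 0) →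
        c * (l2T (efn lam a)) ^ 3 / Real.sqrt (∫ t in (0:ℝ)..L, ‖efn lam a (γ t)‖ ^ 4)
          ≤ ∫ t in (0:ℝ)..L, ‖efn lam a (γ t)‖ := by
  obtain ⟨δ, hδ, lam0, hlam0, hmain⟩ := exists_restriction_L2_lower_bound hL hKmin hsmooth hunit
    fun t ht => (hcurv t ht).1
  refine ⟨Real.sqrt ((δ / (2 * π) ^ 2) ^ 3), by positivity, lam0, hlam0, fun lam hlam a _ _ => ?_⟩
  set A := ∫ t in (0:ℝ)..L, ‖efn lam a (γ t)‖
  set D := ∫ t in (0:ℝ)..L, ‖efn lam a (γ t)‖ ^ 4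
  have hA : 0 ≤ A := intervalIntegral.integral_nonneg hL.le fun t _ => norm_nonneg _
  have hl : 0 ≤ l2T (efn lam a) := Real.sqrt_nonneg _
  have h2 : δ / (2 * π) ^ 2 * l2T (efn lam a) ^ 2 ≤ ∫ t in (0:ℝ)..L, ‖efn lam a (γ t)‖ ^ 2 := by
    rw [l2T_efn_sq, ← mul_assoc, div_mul_cancel₀ _ (by positivity)]
    exact hmain lam hlam a
  have h3 := integral_sq_pow_three_le hL.le (h := fun t => ‖efn lam a (γ t)‖)
    ((continuous_efn lam a).comp hsmooth.continuous).norm fun t => norm_nonneg _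
  refine div_le_of_le_mul₀ (Real.sqrt_nonneg _) hA ?_
  calc Real.sqrt ((δ / (2 * π) ^ 2) ^ 3) * l2T (efn lam a) ^ 3
      = Real.sqrt ((δ / (2 * π) ^ 2 * l2T (efn lam a) ^ 2) ^ 3) := by
        rw [mul_pow (δ / (2 * π) ^ 2) _ 3, Real.sqrt_mul (by positivity), pow_right_comm,
          Real.sqrt_sq (by positivity)]
    _ ≤ Real.sqrt (A ^ 2 * D) :=
        Real.sqrt_le_sqrt ((pow_le_pow_left₀ (by positivity) h2 3).trans h3)
    _ = A * Real.sqrt D := by rw [Real.sqrt_mul (by positivity), Real.sqrt_sq hA]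
end
end

section
/- There is an absolute constant A > 0 with the following property: for every λ ≥ 2, every real c ≥ 1/2, and every arc I of the circle {x ∈ ℝ² : |x| = λ} of arc length c√λ, the number of lattice points of ℤ² lying on I is at most A·c·log λ. -/
open MeasureTheory Real

noncomputable section

/-- The number of lattice points on the arc of the circle of radius `lam` which is the image
of `[θ0, θ0 + s]` under the arc-length parameterization `θ ↦ (lam cos(θ/lam), lam sin(θ/lam))`. -/
def arcCount (lam θ0 s : ℝ) : ℕ := by
  classical
  exact ((Elat lam).filter fun μ => ∃ θ ∈ Set.Icc θ0 (θ0 + s),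
    iv μ = (lam * Real.cos (θ / lam), lam * Real.sin (θ / lam))).card

/-- Vandermonde determinants of points on the conic `z * w = N` are, up to the factor `∏ w ^ h`,
divisible by a large power of `N`. -/
theorem prod_pow_mul_det_vandermonde {R : Type*} [CommRing R] {m : ℕ} (z w : Fin m → R) (N : R)
    (hzw : ∀ i, z i * w i = N) (h : ℕ) :
    (∏ i, w i ^ h) * (Matrix.vandermonde z).det =
      N ^ (∑ j ∈ Finset.range m, min j h) *
        (Matrix.of fun i j : Fin m => z i ^ ((j : ℕ) - h) * w i ^ (h - (j : ℕ))).det := by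
  rw [Finset.sum_range, ← Finset.prod_pow_eq_pow_sum, ← Matrix.det_mul_column,
    ← Matrix.det_mul_row]
  congr 1
  ext i j
  simp only [Matrix.of_apply, Matrix.vandermonde_apply, ← hzw i]
  rcases le_total (j : ℕ) h with hj | hj
  · obtain ⟨k, rfl⟩ := Nat.exists_eq_add_of_le hj
    simp
    ring
  · obtain ⟨k, hk⟩ := Nat.exists_eq_add_of_le hj
    simp [hk]
    ring

theorem sum_range_min (h : ℕ) :
    2 * ∑ j ∈ Finset.range (2 * h + 1), min j h = h ^ 2 + (2 * h + 1) * h := by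
  have aux : ∀ k, 2 * ∑ j ∈ Finset.range (h + k), min j h + h = h ^ 2 + 2 * k * h := by
    intro k
    induction k with
    | zero =>
      have : ∑ j ∈ Finset.range h, min j h = ∑ j ∈ Finset.range h, j :=
        Finset.sum_congr rfl fun j hj => min_eq_left (Finset.mem_range.1 hj).le
      rw [add_zero, this, mul_comm 2, Finset.sum_range_id_mul_two]
      cases h <;> simp
      ring
    | succ k ih =>
      rw [← add_assoc, Finset.sum_range_succ, min_eq_right (Nat.le_add_right h k)]
      linarith
  have := aux (h + 1)
  rw [show h + (h + 1) = 2 * h + 1 by ring] at this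
  linarith

theorem pow_le_norm_det_vandermonde {h : ℕ} (z : Fin (2 * h + 1) → GaussianInt)
    (hz : Function.Injective z) {N : ℤ} (hN : 0 < N) (hzN : ∀ i, (z i).norm = N) :
    N ^ h ^ 2 ≤ (Matrix.vandermonde z).det.norm := by
  have key := prod_pow_mul_det_vandermonde z (fun i => star (z i)) (N : GaussianInt)
    (fun i => by rw [← Zsqrtd.norm_eq_mul_conj, hzN i]) h
  set W := (Matrix.of fun i j : Fin (2 * h + 1) =>
    z i ^ ((j : ℕ) - h) * star (z i) ^ (h - (j : ℕ))).det
  have key' := congrArg (Zsqrtd.normMonoidHom (d := -1)) key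
  simp only [map_mul, map_prod, map_pow] at key'
  simp only [Zsqrtd.normMonoidHom, MonoidHom.coe_mk, OneHom.coe_mk, Zsqrtd.norm_conj, hzN,
    Zsqrtd.norm_intCast, Finset.prod_const, Finset.card_univ, Fintype.card_fin] at key'
  rw [← pow_two, ← pow_mul, ← pow_mul, sum_range_min, pow_add, mul_comm h, mul_comm (N ^ h ^ 2),
    mul_assoc] at key'
  have key'' := mul_left_cancel₀ (pow_ne_zero _ hN.ne') key'
  have hV : (Matrix.vandermonde z).det ≠ 0 := Matrix.det_vandermonde_ne_zero_iff.2 hz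
  have hVpos : 0 < (Matrix.vandermonde z).det.norm := GaussianInt.norm_pos.2 hV
  have hNpos : 0 < N ^ h ^ 2 := pow_pos hN _
  have hW : 0 < W.norm := by
    rw [key''] at hVpos
    exact pos_of_mul_pos_right hVpos hNpos.le
  rw [key'']
  exact le_mul_of_one_le_right hNpos.le hW

theorem norm_det_vandermonde_le {h : ℕ} (z : Fin (2 * h + 1) → GaussianInt) {L : ℝ}
    (hL : ∀ i j, ((z j - z i).norm : ℝ) ≤ L) :
    ((Matrix.vandermonde z).det.norm : ℝ) ≤ L ^ ((2 * h + 1) * h) := by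
  have hcard : ∑ i : Fin (2 * h + 1), (Finset.Ioi i).card = (2 * h + 1) * h := by
    simp only [Fin.card_Ioi]
    rw [← Finset.sum_range (fun i => 2 * h + 1 - 1 - i), Finset.sum_range_reflect (fun i => i)]
    have := Finset.sum_range_id_mul_two (2 * h + 1)
    rw [Nat.add_sub_cancel] at this
    linarith
  have hdet : (Matrix.vandermonde z).det.norm =
      ∏ i, ∏ j ∈ Finset.Ioi i, (z j - z i).norm := by
    rw [Matrix.det_vandermonde]
    exact (map_prod (Zsqrtd.normMonoidHom (d := -1)) _ _).trans
      (Finset.prod_congr rfl fun i _ => map_prod _ _ _)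
  have hnn : ∀ x : GaussianInt, (0 : ℝ) ≤ (x.norm : ℝ) := fun x =>
    Int.cast_nonneg (GaussianInt.norm_nonneg x)
  rw [hdet, ← hcard, ← Finset.prod_pow_eq_pow_sum]
  push_cast
  refine Finset.prod_le_prod (fun i _ => Finset.prod_nonneg fun j _ => hnn _) fun i _ => ?_
  rw [← Finset.prod_const]
  exact Finset.prod_le_prod (fun j _ => hnn _) fun j _ => hL i j

theorem mem_Elat_norm {lam : ℝ} {μ : ℤ × ℤ} (hμ : μ ∈ Elat lam) :
    ((μ.1 : ℝ)) ^ 2 + (μ.2 : ℝ) ^ 2 = lam ^ 2 := by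
  classical
  exact (Finset.mem_filter.1 hμ).2

/-- A set of `2 * h + 1` lattice points on a circle of radius `lam` has diameter at least
`lam ^ (h / (2 * h + 1))`. -/
theorem pow_le_of_card_le {lam L : ℝ} (hlam : 0 < lam) (hL : 0 ≤ L) {h : ℕ} (hh : h ≠ 0)
    {S : Finset (ℤ × ℤ)} (hS : S ⊆ Elat lam) (hcard : 2 * h + 1 ≤ S.card)
    (hdist : ∀ μ ∈ S, ∀ ν ∈ S, ((ν.1 : ℝ) - μ.1) ^ 2 + ((ν.2 : ℝ) - μ.2) ^ 2 ≤ L ^ 2) :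
    lam ^ h ≤ L ^ (2 * h + 1) := by
  obtain ⟨f⟩ : Nonempty (Fin (2 * h + 1) ↪ S) :=
    Function.Embedding.nonempty_of_card_le (by simpa using hcard)
  let z : Fin (2 * h + 1) → GaussianInt := fun i => ⟨(f i).1.1, (f i).1.2⟩
  have hz : Function.Injective z := by
    intro i j hij
    have h1 := congrArg Zsqrtd.re hij
    have h2 := congrArg Zsqrtd.im hij
    exact f.injective (Subtype.ext (Prod.ext h1 h2))
  have hnorm : ∀ i, ((z i).norm : ℝ) = lam ^ 2 := by
    intro i
    rw [← mem_Elat_norm (hS (f i).2)]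
    simp only [Zsqrtd.norm_def, z]
    push_cast
    ring
  have hpos : 0 < (z 0).norm := by
    have : (0 : ℝ) < (z 0).norm := by rw [hnorm]; positivity
    exact_mod_cast this
  have lower := pow_le_norm_det_vandermonde z hz hpos fun i => by
    have : ((z i).norm : ℝ) = (z 0).norm := by rw [hnorm, hnorm]
    exact_mod_cast this
  have lower' : (((z 0).norm : ℝ)) ^ h ^ 2 ≤ ((Matrix.vandermonde z).det.norm : ℝ) := by
    exact_mod_cast lower
  have upper := norm_det_vandermonde_le z (L := L ^ 2) fun i j => by
    refine le_trans (le_of_eq ?_) (hdist _ (f i).2 _ (f j).2)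
    simp only [Zsqrtd.norm_def, z, Zsqrtd.re_sub, Zsqrtd.im_sub]
    push_cast
    ring
  rw [hnorm] at lower'
  have hle := lower'.trans upper
  refine (pow_le_pow_iff_left₀ (by positivity) (by positivity)
    (mul_ne_zero two_ne_zero hh)).1 ?_
  calc (lam ^ h) ^ (2 * h) = (lam ^ 2) ^ h ^ 2 := by ring
    _ ≤ (L ^ 2) ^ ((2 * h + 1) * h) := hle
    _ = (L ^ (2 * h + 1)) ^ (2 * h) := by ring

theorem chord_sq_le_arc_sq {lam : ℝ} (hlam : 0 < lam) (θ φ : ℝ) :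
    (lam * cos (φ / lam) - lam * cos (θ / lam)) ^ 2 +
      (lam * sin (φ / lam) - lam * sin (θ / lam)) ^ 2 ≤ (φ - θ) ^ 2 := by
  have h1 := one_sub_sq_div_two_le_cos (x := φ / lam - θ / lam)
  rw [cos_sub] at h1
  have h2 := mul_le_mul_of_nonneg_left h1 (by positivity : 0 ≤ 2 * lam ^ 2)
  have h3 : 2 * lam ^ 2 * (1 - (φ / lam - θ / lam) ^ 2 / 2) = 2 * lam ^ 2 - (φ - θ) ^ 2 := by
    field_simp
  have h4 := sin_sq_add_cos_sq (φ / lam)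
  have h5 := sin_sq_add_cos_sq (θ / lam)
  have h6 : (lam * cos (φ / lam) - lam * cos (θ / lam)) ^ 2 +
      (lam * sin (φ / lam) - lam * sin (θ / lam)) ^ 2 =
      lam ^ 2 * ((sin (φ / lam) ^ 2 + cos (φ / lam) ^ 2) +
        (sin (θ / lam) ^ 2 + cos (θ / lam) ^ 2)) - 2 * lam ^ 2 *
        (cos (φ / lam) * cos (θ / lam) + sin (φ / lam) * sin (θ / lam)) := by ring
  rw [h4, h5] at h6
  linarith

theorem arcCount_half_sqrt_le {lam : ℝ} (hlam : 2 ≤ lam) (θ0 : ℝ) :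
    (arcCount lam θ0 (√lam / 2) : ℝ) ≤ 5 * log lam := by
  classical
  have hpos : 0 < lam := by linarith
  have hlog2 := log_two_gt_d9
  have hlog : log 2 ≤ log lam := log_le_log two_pos hlam
  have hceil := Nat.ceil_lt_add_one (show 0 ≤ log lam by linarith)
  have hceil' := Nat.le_ceil (log lam)
  set h := ⌈log lam⌉₊ with hh
  have hh0 : h ≠ 0 := (Nat.ceil_pos.2 (by linarith)).ne'
  by_contra! hcon
  have hcard : 2 * h + 1 ≤ arcCount lam θ0 (√lam / 2) := by
    have : (2 * h : ℝ) < arcCount lam θ0 (√lam / 2) := by linarith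
    exact_mod_cast this
  have key := pow_le_of_card_le hpos (L := √lam / 2) (by positivity) hh0
    (Finset.filter_subset _ _) hcard (by
      intro μ hμ ν hν
      obtain ⟨-, θ, hθ, hμθ⟩ := Finset.mem_filter.1 hμ
      obtain ⟨-, φ, hφ, hνφ⟩ := Finset.mem_filter.1 hν
      obtain ⟨h1, h2⟩ := Prod.ext_iff.1 hμθ
      obtain ⟨h3, h4⟩ := Prod.ext_iff.1 hνφ
      simp only [iv] at h1 h2 h3 h4
      rw [h1, h2, h3, h4]
      refine (chord_sq_le_arc_sq hpos θ φ).trans (sq_le_sq.2 ?_)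
      rw [abs_of_nonneg (show 0 ≤ √lam / 2 by positivity), abs_le]
      constructor <;> linarith [hθ.1, hθ.2, hφ.1, hφ.2])
  have hsq : (√lam) ^ (2 * h) = lam ^ h := by rw [pow_mul, sq_sqrt hpos.le]
  rw [div_pow, pow_succ (√lam), hsq, le_div_iff₀ (by positivity)] at key
  have key2 : (2 : ℝ) ^ (2 * h + 1) ≤ √lam := le_of_mul_le_mul_left key (by positivity)
  have key3 := log_le_log (by positivity) key2
  rw [log_pow, log_sqrt hpos.le] at key3
  push_cast at key3
  nlinarith

theorem arcCount_mono {lam θ0 s t : ℝ} (hst : s ≤ t) :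
    arcCount lam θ0 s ≤ arcCount lam θ0 t := by
  classical
  refine Finset.card_le_card (Finset.monotone_filter_right _ ?_)
  rintro μ - ⟨θ, hθ, hμ⟩
  exact ⟨θ, ⟨hθ.1, by linarith [hθ.2]⟩, hμ⟩

theorem arcCount_add_le (lam θ0 s t : ℝ) :
    arcCount lam θ0 (s + t) ≤ arcCount lam θ0 s + arcCount lam (θ0 + s) t := by
  classical
  refine le_trans (Finset.card_le_card ?_) (Finset.card_union_le _ _)
  intro μ hμ
  obtain ⟨hE, θ, hθ, hμθ⟩ := Finset.mem_filter.1 hμ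
  rcases le_total θ (θ0 + s) with hle | hle
  · exact Finset.mem_union_left _ (Finset.mem_filter.2 ⟨hE, θ, ⟨hθ.1, hle⟩, hμθ⟩)
  · exact Finset.mem_union_right _
      (Finset.mem_filter.2 ⟨hE, θ, ⟨hle, by linarith [hθ.2]⟩, hμθ⟩)

theorem arcCount_nsmul_le {lam δ B : ℝ} (hB : ∀ θ0, (arcCount lam θ0 δ : ℝ) ≤ B) (θ0 : ℝ)
    (k : ℕ) : (arcCount lam θ0 ((k + 1) * δ) : ℝ) ≤ (k + 1) * B := by
  induction k with
  | zero => simpa using hB θ0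
  | succ k ih =>
    have h1 : (arcCount lam θ0 ((k + 1) * δ + δ) : ℝ) ≤
        arcCount lam θ0 ((k + 1) * δ) + arcCount lam (θ0 + (k + 1) * δ) δ := by
      exact_mod_cast arcCount_add_le lam θ0 ((k + 1) * δ) δ
    have h2 := hB (θ0 + (k + 1) * δ)
    push_cast
    rw [show ((k : ℝ) + 1 + 1) * δ = (k + 1) * δ + δ by ring]
    linarith

/-- Any arc of length `c·√lam` (with `c ≥ 1/2`) of the circle of radius `lam` contains at most
`O(c · log lam)` lattice points. -/
theorem lattice_points_in_short_arcs :
    ∃ A > (0:ℝ), ∀ lam : ℝ, 2 ≤ lam → ∀ c : ℝ, 1/2 ≤ c → ∀ θ0 : ℝ,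
      (arcCount lam θ0 (c * Real.sqrt lam) : ℝ) ≤ A * c * Real.log lam := by
  refine ⟨20, by norm_num, fun lam hlam c hc θ0 => ?_⟩
  have hfloor : (⌊2 * c⌋₊ : ℝ) ≤ 2 * c := Nat.floor_le (by linarith)
  have hcover : c * √lam ≤ (⌊2 * c⌋₊ + 1) * (√lam / 2) := by
    nlinarith [Nat.lt_floor_add_one (2 * c), sqrt_nonneg lam]
  have hlog : 0 ≤ log lam := log_nonneg (by linarith)
  calc (arcCount lam θ0 (c * √lam) : ℝ)
      ≤ arcCount lam θ0 ((⌊2 * c⌋₊ + 1) * (√lam / 2)) := by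
        exact_mod_cast arcCount_mono hcover
    _ ≤ (⌊2 * c⌋₊ + 1) * (5 * log lam) :=
        arcCount_nsmul_le (arcCount_half_sqrt_le hlam) θ0 _
    _ ≤ 4 * c * (5 * log lam) := by gcongr; linarith
    _ = 20 * c * log lam := by ring
end
end

section
/- There is an absolute constant A > 0 with the following property: for every λ ≥ 2 and all vectors z, v ∈ ℝ², the number of medians w ∈ Z_λ with 0 < |w| ≤ λ satisfying both |μ₊(w) − v| < √λ and |w − z| < λ^{1/3} is at most A·B_λ. -/
open MeasureTheory Real

noncomputable section

/-- `Z_lam`: the set of medians `(μ+ν)/2` of pairs of lattice points on the circle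
of radius `lam`. -/
def Zmed (lam : ℝ) : Finset (ℝ × ℝ) := by
  classical
  exact ((Elat lam) ×ˢ (Elat lam)).image fun p => ((1:ℝ)/2) • (iv p.1 + iv p.2)

/-- `Δ(z) = √(lam² - |z|²)`, half the distance between the two points of the circle of
radius `lam` with midpoint `z`. -/
def Del (lam : ℝ) (z : ℝ × ℝ) : ℝ := Real.sqrt (lam ^ 2 - (e2 z) ^ 2)

/-- Rotation of a plane vector by `π/2`. -/
def perp (z : ℝ × ℝ) : ℝ × ℝ := (-z.2, z.1)

/-- `μ₊(z) = z + Δ(z)·z^⊥/|z^⊥|`, one of the two points on the circle of radius `lam`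
whose midpoint is `z`. -/
def mup (lam : ℝ) (z : ℝ × ℝ) : ℝ × ℝ := z + (Del lam z / e2 z) • perp z

/-- The number of medians `w ∈ Z_lam`, `0 < |w| ≤ lam`, with `|μ₊(w) - v| < √lam` and
`|w - z| < lam^{1/3}`. -/
def stableMedCount (lam : ℝ) (z v : ℝ × ℝ) : ℕ := by
  classical
  exact ((Zmed lam).filter fun w => 0 < e2 w ∧ e2 w ≤ lam ∧
    e2 (mup lam w - v) < Real.sqrt lam ∧ e2 (w - z) < lam ^ ((1:ℝ)/3)).card

lemma e2_sq (x : ℝ × ℝ) : e2 x ^ 2 = x.1 ^ 2 + x.2 ^ 2 :=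
  Real.sq_sqrt (by positivity)

lemma abs_fst_le_e2 (x : ℝ × ℝ) : |x.1| ≤ e2 x :=
  Real.abs_le_sqrt (by nlinarith [sq_nonneg x.2])

lemma abs_snd_le_e2 (x : ℝ × ℝ) : |x.2| ≤ e2 x :=
  Real.abs_le_sqrt (by nlinarith [sq_nonneg x.1])

/-- A finite set of lattice points in an open square of side `2Ks`, at most `N` of which lie in
any square of side `s`, has at most `(2K)²N` elements. -/
lemma card_le_of_card_cell_le (S : Finset (ℤ × ℤ)) (c : ℝ × ℝ) {s : ℝ} (hs : 0 < s) (K N : ℕ)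
    (hbox : ∀ x ∈ S, |(iv x - c).1| < K * s ∧ |(iv x - c).2| < K * s)
    (hcell : ∀ T ⊆ S, (∀ x ∈ T, ∀ y ∈ T, |(iv x - iv y).1| < s ∧ |(iv x - iv y).2| < s) →
      T.card ≤ N) :
    S.card ≤ N * (2 * K) ^ 2 := by
  classical
  let f : ℤ × ℤ → ℤ × ℤ := fun x => (⌊(iv x - c).1 / s⌋, ⌊(iv x - c).2 / s⌋)
  let I : Finset ℤ := Finset.Ico (-(K : ℤ)) K
  have floor_mem : ∀ t : ℝ, |t| < K * s → ⌊t / s⌋ ∈ I := by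
    intro t ht
    obtain ⟨h1, h2⟩ := abs_lt.1 ht
    rw [Finset.mem_Ico, Int.le_floor, Int.floor_lt, le_div_iff₀ hs, div_lt_iff₀ hs]
    push_cast
    constructor <;> linarith
  have hmaps : ∀ x ∈ S, f x ∈ I ×ˢ I := fun x hx =>
    Finset.mem_product.2 ⟨floor_mem _ (hbox x hx).1, floor_mem _ (hbox x hx).2⟩
  have near : ∀ a b : ℝ, ⌊a / s⌋ = ⌊b / s⌋ → |a - b| < s := by
    intro a b hab
    have h := Int.abs_sub_lt_one_of_floor_eq_floor hab
    rwa [← sub_div, abs_div, abs_of_pos hs, div_lt_one hs] at h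
  have key := Finset.card_le_mul_card_image_of_maps_to hmaps N (fun b _ => by
    refine hcell _ (Finset.filter_subset _ _) fun x hx y hy => ?_
    have hxy : f x = f y := (Finset.mem_filter.1 hx).2.trans (Finset.mem_filter.1 hy).2.symm
    have h1 := near _ _ (congrArg Prod.fst hxy)
    have h2 := near _ _ (congrArg Prod.snd hxy)
    simp only [Prod.fst_sub, Prod.snd_sub, sub_sub_sub_cancel_right] at h1 h2 ⊢
    exact ⟨h1, h2⟩)
  have hI : (I ×ˢ I).card = (2 * K) ^ 2 := by
    have : I.card = 2 * K := by
      simp only [I, Int.card_Ico]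
      omega
    rw [Finset.card_product, this, sq]
  rwa [hI] at key

/-- `Bmax` bounds the number of lattice points of the circle near one of its points. -/
lemma card_le_Bmax {lam : ℝ} (hlam : 0 ≤ lam) {T : Finset (ℤ × ℤ)} (hT : T ⊆ Elat lam)
    {p : ℤ × ℤ} (hp : p ∈ Elat lam) (hnear : ∀ x ∈ T, e2 (iv x - iv p) ≤ √lam) :
    T.card ≤ Bmax lam := by
  classical
  have hep : e2 (iv p) = lam := by
    have h := mem_Elat hp
    simp only [e2, iv]
    rw [h, Real.sqrt_sq hlam]
  calc T.card ≤ ((Elat lam).filter fun ξ => e2 (iv ξ - iv p) ≤ √lam).card :=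
        Finset.card_le_card fun x hx => Finset.mem_filter.2 ⟨hT hx, hnear x hx⟩
    _ ≤ Bmax lam := by
        unfold Bmax
        refine le_csSup ⟨(Elat lam).card, ?_⟩ ⟨iv p, hep, by congr⟩
        rintro n ⟨x, -, rfl⟩
        exact Finset.card_le_card (Finset.filter_subset _ _)

lemma card_ball_le {lam : ℝ} (hlam : 0 < lam) (v : ℝ × ℝ) {P : Finset (ℤ × ℤ)}
    (hP : ∀ x ∈ P, x ∈ Elat lam ∧ e2 (iv x - v) < √lam) :
    P.card ≤ Bmax lam * 16 := by
  have hr := Real.sqrt_pos.2 hlam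
  refine card_le_of_card_cell_le P v (half_pos hr) 2 (Bmax lam) (fun x hx => ?_)
    (fun T hT hnear => ?_)
  · push_cast
    rw [mul_div_cancel₀ _ (two_ne_zero)]
    exact ⟨(abs_fst_le_e2 _).trans_lt (hP x hx).2, (abs_snd_le_e2 _).trans_lt (hP x hx).2⟩
  · rcases T.eq_empty_or_nonempty with rfl | ⟨p, hp⟩
    · simp
    · refine card_le_Bmax hlam.le (fun x hx => (hP x (hT hx)).1) (hP p (hT hp)).1 fun x hx => ?_
      obtain ⟨h1, h2⟩ := hnear x hx p hp
      apply Real.sqrt_le_sqrt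
      have h1' := sq_lt_sq' (abs_lt.1 h1).1 (abs_lt.1 h1).2
      have h2' := sq_lt_sq' (abs_lt.1 h2).1 (abs_lt.1 h2).2
      have h3 := Real.sq_sqrt hlam.le
      nlinarith

/-- The circumradius formula for a triangle inscribed in a circle centred at the origin. -/
lemma four_mul_sq_mul_det_sq {a₁ a₂ b₁ b₂ c₁ c₂ L : ℝ} (ha : a₁ ^ 2 + a₂ ^ 2 = L)
    (hb : b₁ ^ 2 + b₂ ^ 2 = L) (hc : c₁ ^ 2 + c₂ ^ 2 = L) :
    4 * L * ((b₁ - a₁) * (c₂ - a₂) - (b₂ - a₂) * (c₁ - a₁)) ^ 2 =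
      ((b₁ - a₁) ^ 2 + (b₂ - a₂) ^ 2) * ((c₁ - a₁) ^ 2 + (c₂ - a₂) ^ 2) *
        ((c₁ - b₁) ^ 2 + (c₂ - b₂) ^ 2) := by
  obtain ⟨u₁, rfl⟩ : ∃ u, b₁ = a₁ + u := ⟨b₁ - a₁, by ring⟩
  obtain ⟨u₂, rfl⟩ : ∃ u, b₂ = a₂ + u := ⟨b₂ - a₂, by ring⟩
  obtain ⟨w₁, rfl⟩ : ∃ u, c₁ = a₁ + u := ⟨c₁ - a₁, by ring⟩
  obtain ⟨w₂, rfl⟩ : ∃ u, c₂ = a₂ + u := ⟨c₂ - a₂, by ring⟩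
  have hu : 2 * (a₁ * u₁ + a₂ * u₂) = -(u₁ ^ 2 + u₂ ^ 2) := by linarith
  have hw : 2 * (a₁ * w₁ + a₂ * w₂) = -(w₁ ^ 2 + w₂ ^ 2) := by linarith
  have h1 : 2 * (u₁ * w₂ - u₂ * w₁) * a₁ =
      -((u₁ ^ 2 + u₂ ^ 2) * w₂ - (w₁ ^ 2 + w₂ ^ 2) * u₂) := by
    linear_combination w₂ * hu - u₂ * hw
  have h2 : 2 * (u₁ * w₂ - u₂ * w₁) * a₂ =
      -((w₁ ^ 2 + w₂ ^ 2) * u₁ - (u₁ ^ 2 + u₂ ^ 2) * w₁) := by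
    linear_combination u₁ * hw - w₁ * hu
  calc _ = (2 * (u₁ * w₂ - u₂ * w₁) * a₁) ^ 2 + (2 * (u₁ * w₂ - u₂ * w₁) * a₂) ^ 2 := by
        rw [← ha]; ring
    _ = _ := by rw [h1, h2]; ring

lemma iv_dist_sq_pos {a b : ℤ × ℤ} (hab : a ≠ b) :
    0 < ((b.1 : ℝ) - a.1) ^ 2 + ((b.2 : ℝ) - a.2) ^ 2 := by
  by_contra! h
  apply hab
  have s1 := sq_nonneg ((b.1 : ℝ) - a.1)
  have s2 := sq_nonneg ((b.2 : ℝ) - a.2)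
  have h1 : ((b.1 : ℝ) - a.1) ^ 2 = 0 := by linarith
  have h2 : ((b.2 : ℝ) - a.2) ^ 2 = 0 := by linarith
  have hfst := sub_eq_zero.1 (pow_eq_zero_iff two_ne_zero |>.1 h1)
  have hsnd := sub_eq_zero.1 (pow_eq_zero_iff two_ne_zero |>.1 h2)
  exact Prod.ext (by exact_mod_cast hfst.symm) (by exact_mod_cast hsnd.symm)

/-- At most two lattice points of the circle lie in a square of side `s` if `2s⁶ ≤ lam²`. -/
lemma card_cell_le_two {lam s : ℝ} (hs : 2 * s ^ 6 ≤ lam ^ 2) {T : Finset (ℤ × ℤ)}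
    (hT : T ⊆ Elat lam)
    (hnear : ∀ x ∈ T, ∀ y ∈ T, |(iv x - iv y).1| < s ∧ |(iv x - iv y).2| < s) :
    T.card ≤ 2 := by
  by_contra! hcard
  obtain ⟨a, b, c, ha, hb, hc, hab, hac, hbc⟩ := Finset.two_lt_card_iff.1 hcard
  have side : ∀ x ∈ T, ∀ y ∈ T, ((y.1 : ℝ) - x.1) ^ 2 + ((y.2 : ℝ) - x.2) ^ 2 < 2 * s ^ 2 := by
    intro x hx y hy
    obtain ⟨h1, h2⟩ := hnear y hy x hx
    have h1' := sq_lt_sq' (abs_lt.1 h1).1 (abs_lt.1 h1).2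
    have h2' := sq_lt_sq' (abs_lt.1 h2).1 (abs_lt.1 h2).2
    simp only [iv, Prod.fst_sub, Prod.snd_sub] at h1' h2'
    linarith
  have key := four_mul_sq_mul_det_sq (mem_Elat (hT ha)) (mem_Elat (hT hb)) (mem_Elat (hT hc))
  have pab := iv_dist_sq_pos hab
  have pac := iv_dist_sq_pos hac
  have pbc := iv_dist_sq_pos hbc
  have hlt := mul_lt_mul'' (mul_lt_mul'' (side a ha b hb) (side a ha c hc) pab.le pac.le)
    (side b hb c hc) (mul_pos pab pac).le pbc.le
  have hpos := mul_pos (mul_pos pab pac) pbc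
  rw [← key] at hlt hpos
  let D : ℤ := (b.1 - a.1) * (c.2 - a.2) - (b.2 - a.2) * (c.1 - a.1)
  have hD : ((b.1 : ℝ) - a.1) * (c.2 - a.2) - (b.2 - a.2) * (c.1 - a.1) = (D : ℝ) := by
    simp only [D]; push_cast; ring
  rw [hD] at hlt hpos
  have hD0 : D ≠ 0 := by
    intro h
    simp [h] at hpos
  have hD1 : (1 : ℝ) ≤ (D : ℝ) ^ 2 := by
    exact_mod_cast Int.one_le_abs (pow_ne_zero 2 hD0) |>.trans_eq (abs_of_nonneg (sq_nonneg D))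
  nlinarith [mul_le_mul_of_nonneg_left hD1 (sq_nonneg lam)]

lemma card_small_ball_le {lam : ℝ} (hlam : 0 < lam) (c : ℝ × ℝ) {S : Finset (ℤ × ℤ)}
    (hS : ∀ x ∈ S, x ∈ Elat lam ∧ e2 (iv x - c) < 2 * lam ^ ((1 : ℝ) / 3)) :
    S.card ≤ 128 := by
  have hr : 0 < lam ^ ((1 : ℝ) / 3) := Real.rpow_pos_of_pos hlam _
  have hr3 : (lam ^ ((1 : ℝ) / 3)) ^ 3 = lam := by
    rw [← Real.rpow_natCast, ← Real.rpow_mul hlam.le]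
    norm_num
  set r := lam ^ ((1 : ℝ) / 3)
  refine card_le_of_card_cell_le S c (half_pos hr) 4 2 (fun x hx => ?_) (fun T hT hnear => ?_)
  · have h := (hS x hx).2
    have h1 := abs_fst_le_e2 (iv x - c)
    have h2 := abs_snd_le_e2 (iv x - c)
    push_cast
    constructor <;> linarith
  · refine card_cell_le_two ?_ (fun x hx => (hS x (hT hx)).1) hnear
    rw [← hr3]
    nlinarith [pow_pos hr 6]

/-- If `w ≠ 0` is a median then `μ₊(w)` and `μ₋(w) = 2w - μ₊(w)` are lattice points. -/
lemma exists_endpoints_of_mem_Zmed {lam : ℝ} {w : ℝ × ℝ} (hw : w ∈ Zmed lam) (hw0 : 0 < e2 w) :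
    ∃ m ∈ Elat lam, ∃ n ∈ Elat lam, iv m = mup lam w ∧ w = ((1 : ℝ) / 2) • (iv m + iv n) := by
  classical
  unfold Zmed at hw
  obtain ⟨⟨p, q⟩, hpq, rfl⟩ := Finset.mem_image.1 hw
  obtain ⟨hp, hq⟩ := Finset.mem_product.1 hpq
  have hp' := mem_Elat hp
  have hq' := mem_Elat hq
  simp only at hp hq hp' hq' hw0 ⊢
  set w : ℝ × ℝ := ((1 : ℝ) / 2) • (iv p + iv q) with hwdef
  have w1 : w.1 = (p.1 + q.1) / 2 := by simp [hwdef, iv]; ring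
  have w2 : w.2 = (p.2 + q.2) / 2 := by simp [hwdef, iv]; ring
  have hsq := e2_sq w
  have horth : ((p.1 : ℝ) - q.1) * w.1 + (p.2 - q.2) * w.2 = 0 := by
    rw [w1, w2]; linear_combination (hp' - hq') / 2
  obtain ⟨t, ht⟩ : ∃ t : ℝ, t = ((p.2 - q.2) / 2 * w.1 - (p.1 - q.1) / 2 * w.2) / e2 w ^ 2 :=
    ⟨_, rfl⟩
  have htw : t * e2 w ^ 2 = (p.2 - q.2) / 2 * w.1 - (p.1 - q.1) / 2 * w.2 := by
    rw [ht]; field_simp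
  have hd1 : t * (-w.2) = (p.1 - q.1) / 2 := by
    apply mul_left_cancel₀ (pow_pos hw0 2).ne'
    linear_combination (-w.2) * htw - (p.1 - q.1) / 2 * hsq - w.1 / 2 * horth
  have hd2 : t * w.1 = (p.2 - q.2) / 2 := by
    apply mul_left_cancel₀ (pow_pos hw0 2).ne'
    linear_combination w.1 * htw - (p.2 - q.2) / 2 * hsq - w.2 / 2 * horth
  have hDel : lam ^ 2 - e2 w ^ 2 = (t * e2 w) ^ 2 := by
    have h : (t * e2 w) ^ 2 = (t * (-w.2)) ^ 2 + (t * w.1) ^ 2 := by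
      rw [mul_pow, hsq]; ring
    rw [h, hd1, hd2, hsq, w1, w2]
    linear_combination -(hp' + hq') / 2
  have hdiv : Del lam w / e2 w = |t| := by
    rw [Del, hDel, Real.sqrt_sq_eq_abs, abs_mul, abs_of_pos hw0, mul_div_cancel_right₀ _ hw0.ne']
  rcases abs_choice t with habs | habs
  · refine ⟨p, hp, q, hq, ?_, rfl⟩
    rw [mup, hdiv, habs]
    refine Prod.ext ?_ ?_
    · simp only [iv, perp, Prod.fst_add, Prod.smul_fst, smul_eq_mul]
      rw [hd1, w1]; ring
    · simp only [iv, perp, Prod.snd_add, Prod.smul_snd, smul_eq_mul]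
      rw [hd2, w2]; ring
  · refine ⟨q, hq, p, hp, ?_, by rw [hwdef, add_comm]⟩
    rw [mup, hdiv, habs]
    refine Prod.ext ?_ ?_
    · simp only [iv, perp, Prod.fst_add, Prod.smul_fst, smul_eq_mul]
      rw [neg_mul, hd1, w1]; ring
    · simp only [iv, perp, Prod.snd_add, Prod.smul_snd, smul_eq_mul]
      rw [neg_mul, hd2, w2]; ring

lemma e2_two_smul (x : ℝ × ℝ) : e2 ((2 : ℝ) • x) = 2 * e2 x := by
  have h : ((2 : ℝ) • x).1 ^ 2 + ((2 : ℝ) • x).2 ^ 2 = 2 ^ 2 * (x.1 ^ 2 + x.2 ^ 2) := by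
    simp only [Prod.smul_fst, Prod.smul_snd, smul_eq_mul]; ring
  rw [e2, h, Real.sqrt_mul (by norm_num), Real.sqrt_sq (by norm_num), e2]

/-- Stability lemma: given `z, v ∈ ℝ²`, the number of medians `w ∈ Z_lam` with
`|μ₊(w) - v| < √lam` and `|w - z| < lam^{1/3}` is `O(B_lam)`. -/
theorem median_stability :
    ∃ A > (0:ℝ), ∀ lam : ℝ, 2 ≤ lam → ∀ z v : ℝ × ℝ,
      (stableMedCount lam z v : ℝ) ≤ A * (Bmax lam : ℝ) := by
  classical
  refine ⟨2048, by norm_num, fun lam hlam z v => ?_⟩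
  have hpos : 0 < lam := by linarith
  let P := (Elat lam).filter fun m => e2 (iv m - v) < √lam
  let Q : ℤ × ℤ → Finset (ℤ × ℤ) := fun m =>
    (Elat lam).filter fun n => e2 (iv n - ((2 : ℝ) • z - iv m)) < 2 * lam ^ ((1 : ℝ) / 3)
  have hP : P.card ≤ Bmax lam * 16 := card_ball_le hpos v fun x hx => Finset.mem_filter.1 hx
  have hQ : ∀ m ∈ P, (Q m).card ≤ 128 := fun m _ =>
    card_small_ball_le hpos _ fun x hx => Finset.mem_filter.1 hx
  have hcover : stableMedCount lam z v ≤
      ((P.sigma Q).image fun x => ((1 : ℝ) / 2) • (iv x.1 + iv x.2)).card := by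
    unfold stableMedCount
    refine Finset.card_le_card fun w hw => ?_
    obtain ⟨hwZ, hw0, -, hwv, hwz⟩ := Finset.mem_filter.1 hw
    obtain ⟨m, hm, n, hn, hmup, rfl⟩ := exists_endpoints_of_mem_Zmed hwZ hw0
    refine Finset.mem_image.2 ⟨⟨m, n⟩, Finset.mem_sigma.2
      ⟨Finset.mem_filter.2 ⟨hm, by rwa [hmup]⟩, Finset.mem_filter.2 ⟨hn, ?_⟩⟩, rfl⟩
    have h : iv n - ((2 : ℝ) • z - iv m) = (2 : ℝ) • (((1 : ℝ) / 2) • (iv m + iv n) - z) := by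
      module
    rw [h, e2_two_smul]
    linarith
  have hcount : stableMedCount lam z v ≤ 2048 * Bmax lam :=
    calc stableMedCount lam z v ≤ (P.sigma Q).card := hcover.trans Finset.card_image_le
      _ = ∑ m ∈ P, (Q m).card := Finset.card_sigma _ _
      _ ≤ P.card * 128 := by
        simpa using Finset.sum_le_card_nsmul P _ 128 hQ
      _ ≤ 2048 * Bmax lam := by omega
  exact_mod_cast hcount
end
end

section
/- Let γ : [0,L] → ℝ² be a smooth unit-speed curve whose curvature κ(t) satisfies 0 < K_min ≤ κ(t) ≤ K_max and whose total curvature ∫₀^L κ(t) dt is less than π/2. There is an absolute constant σ₀ > 0 (e.g. σ₀ = 1/4) such that for every 0 < σ < σ₀ and every nonzero μ ∈ ℝ², the set B_μ = {t ∈ [0,L] : |φ_μ'(t)| < 2σ} is an interval (possibly empty) of length at most 8σ/K_min, where φ_μ(t) = ⟨μ/|μ|, γ(t)⟩. -/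
open MeasureTheory Real

noncomputable section

/-- If `(f, g)` rotates with angular velocity `k` on `[0, L]` and `g` vanishes at `c`, then
`f = f c * cos θ`, where `θ` is the angle swept out from `c`. -/
theorem eq_mul_cos_of_rotating {L : ℝ} (hL : 0 < L) {f g k : ℝ → ℝ} (hk : Continuous k)
    (hf : ∀ t ∈ Set.Icc (0 : ℝ) L, HasDerivAt f (k t * g t) t)
    (hg : ∀ t ∈ Set.Icc (0 : ℝ) L, HasDerivAt g (-(k t * f t)) t)
    {c : ℝ} (hc : c ∈ Set.Icc (0 : ℝ) L) (hgc : g c = 0) {t : ℝ} (ht : t ∈ Set.Icc (0 : ℝ) L) :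
    f t = f c * cos (∫ s in c..t, k s) := by
  have hθ (t : ℝ) : HasDerivAt (fun t => ∫ s in c..t, k s) (k t) t :=
    intervalIntegral.integral_hasDerivAt_right (hk.intervalIntegrable _ _)
      hk.aestronglyMeasurable.stronglyMeasurableAtFilter hk.continuousAt
  have const (F : ℝ → ℝ) (hF : ∀ t ∈ Set.Icc (0 : ℝ) L, HasDerivAt F 0 t) : F t = F c := by
    have key := constant_of_derivWithin_zero
      (fun s hs => (hF s hs).differentiableAt.differentiableWithinAt)
      (fun s hs => (hF s (Set.Ico_subset_Icc_self hs)).hasDerivWithinAt.derivWithin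
        (uniqueDiffOn_Icc hL s (Set.Ico_subset_Icc_self hs)))
    rw [key t ht, key c hc]
  have h1 := const (fun t => f t * cos (∫ s in c..t, k s) - g t * sin (∫ s in c..t, k s))
    fun s hs => by
      refine (((hf s hs).mul (hθ s).cos).sub ((hg s hs).mul (hθ s).sin)).congr_deriv ?_
      ring
  have h2 := const (fun t => f t * sin (∫ s in c..t, k s) + g t * cos (∫ s in c..t, k s))
    fun s hs => by
      refine (((hf s hs).mul (hθ s).sin).add ((hg s hs).mul (hθ s).cos)).congr_deriv ?_
      ring
  simp only [intervalIntegral.integral_same, cos_zero, sin_zero, hgc] at h1 h2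
  linear_combination cos (∫ s in c..t, k s) * h1 + sin (∫ s in c..t, k s) * h2 -
    f t * sin_sq_add_cos_sq (∫ s in c..t, k s)

theorem half_le_cos_sq {x : ℝ} (hx : |x| ≤ π / 4) : 1 / 2 ≤ cos x ^ 2 := by
  have h : 0 ≤ cos (2 * x) := by
    apply cos_nonneg_of_neg_pi_div_two_le_of_le <;> linarith [abs_le.1 hx]
  rw [cos_two_mul] at h
  linarith

/-- If `(f, g)` is a unit vector rotating with angular velocity `k` by a total angle less than
`π / 2`, then `g` does not vanish between two points where `|f|` is less than `1 / 2`. -/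
theorem ne_zero_of_rotating {L : ℝ} (hL : 0 < L) {f g k : ℝ → ℝ} (hk : Continuous k)
    (hf : ∀ t ∈ Set.Icc (0 : ℝ) L, HasDerivAt f (k t * g t) t)
    (hg : ∀ t ∈ Set.Icc (0 : ℝ) L, HasDerivAt g (-(k t * f t)) t)
    (hfg : ∀ t ∈ Set.Icc (0 : ℝ) L, f t ^ 2 + g t ^ 2 = 1)
    (htot : ∫ t in (0 : ℝ)..L, |k t| < π / 2)
    {a b c : ℝ} (ha : 0 ≤ a) (hb : b ≤ L) (hac : a ≤ c) (hcb : c ≤ b)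
    (hfa : |f a| < 1 / 2) (hfb : |f b| < 1 / 2) : g c ≠ 0 := by
  intro hgc
  have hc : c ∈ Set.Icc (0 : ℝ) L := ⟨ha.trans hac, hcb.trans hb⟩
  have hfc : f c ^ 2 = 1 := by simpa [hgc] using hfg c hc
  have large (t : ℝ) (ht : t ∈ Set.Icc (0 : ℝ) L) (hft : |f t| < 1 / 2) :
      π / 4 < |∫ s in c..t, k s| := by
    by_contra! h
    have h1 := eq_mul_cos_of_rotating hL hk hf hg hc hgc ht
    have h2 : f t ^ 2 = cos (∫ s in c..t, k s) ^ 2 := by rw [h1, mul_pow, hfc, one_mul]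
    have h3 := half_le_cos_sq h
    have h4 := abs_lt.1 hft
    nlinarith
  have hA := large a ⟨ha, by linarith⟩ hfa
  have hB := large b ⟨by linarith, hb⟩ hfb
  rw [intervalIntegral.integral_symm, abs_neg] at hA
  have hA' := intervalIntegral.abs_integral_le_integral_abs (f := k) (μ := volume) hac
  have hB' := intervalIntegral.abs_integral_le_integral_abs (f := k) (μ := volume) hcb
  have hi (x y : ℝ) : IntervalIntegrable (fun t => |k t|) volume x y :=
    hk.abs.intervalIntegrable _ _
  have hadd := intervalIntegral.integral_add_adjacent_intervals (hi a c) (hi c b)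
  have hmono := intervalIntegral.integral_mono_interval (μ := volume) ha (hac.trans hcb) hb
    (Filter.Eventually.of_forall fun t => abs_nonneg (k t)) (hi 0 L)
  linarith

/-- The near-stationary set of a component of a rotating unit vector is an interval. -/
theorem ordConnected_of_rotating {L Kmin σ : ℝ} (hL : 0 < L) (hK : 0 < Kmin) {f g k : ℝ → ℝ}
    (hk : Continuous k)
    (hf : ∀ t ∈ Set.Icc (0 : ℝ) L, HasDerivAt f (k t * g t) t)
    (hg : ∀ t ∈ Set.Icc (0 : ℝ) L, HasDerivAt g (-(k t * f t)) t)
    (hfg : ∀ t ∈ Set.Icc (0 : ℝ) L, f t ^ 2 + g t ^ 2 = 1)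
    (htot : ∫ t in (0 : ℝ)..L, |k t| < π / 2)
    (hkK : ∀ t ∈ Set.Icc (0 : ℝ) L, Kmin ≤ |k t|) (hσ : σ < 1 / 4) :
    {t ∈ Set.Icc (0 : ℝ) L | |f t| < 2 * σ}.OrdConnected := by
  refine ⟨fun a ⟨ha, hfa⟩ b ⟨hb, hfb⟩ c hc => ?_⟩
  have hsub : Set.Icc a b ⊆ Set.Icc 0 L := Set.Icc_subset_Icc ha.1 hb.2
  refine ⟨hsub hc, ?_⟩
  have hne : ∀ t ∈ Set.Icc a b, k t * g t ≠ 0 := fun t ht =>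
    mul_ne_zero (abs_pos.1 (hK.trans_le (hkK t (hsub ht))))
      (ne_zero_of_rotating hL hk hf hg hfg htot ha.1 hb.2 ht.1 ht.2 (by linarith) (by linarith))
  have hcont : ContinuousOn f (Set.Icc a b) := fun t ht =>
    (hf t (hsub ht)).continuousAt.continuousWithinAt
  have hab := hc.1.trans hc.2
  have hal : a ∈ Set.Icc a b := Set.left_mem_Icc.2 hab
  have hbr : b ∈ Set.Icc a b := Set.right_mem_Icc.2 hab
  rw [abs_lt] at hfa hfb ⊢
  rcases hasDerivWithinAt_forall_lt_or_forall_gt_of_forall_ne (convex_Icc a b)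
    (fun t ht => (hf t (hsub ht)).hasDerivWithinAt) hne with h | h
  · have hm : AntitoneOn f (Set.Icc a b) := antitoneOn_of_hasDerivWithinAt_nonpos
      (convex_Icc a b) hcont
      (fun t ht => (hf t (hsub (interior_subset ht))).hasDerivWithinAt)
      (fun t ht => (h t (interior_subset ht)).le)
    have h1 := hm hal hc hc.1
    have h2 := hm hc hbr hc.2
    constructor <;> linarith
  · have hm : MonotoneOn f (Set.Icc a b) := monotoneOn_of_hasDerivWithinAt_nonneg
      (convex_Icc a b) hcont
      (fun t ht => (hf t (hsub (interior_subset ht))).hasDerivWithinAt)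
      (fun t ht => (h t (interior_subset ht)).le)
    have h1 := hm hal hc hc.1
    have h2 := hm hc hbr hc.2
    constructor <;> linarith

/-- An interval on which a component `f` of a rotating unit vector is small is short. -/
theorem volume_le_of_rotating {L Kmin σ : ℝ} (hK : 0 < Kmin) {f g k : ℝ → ℝ}
    (hf : ∀ t ∈ Set.Icc (0 : ℝ) L, HasDerivAt f (k t * g t) t)
    (hfg : ∀ t ∈ Set.Icc (0 : ℝ) L, f t ^ 2 + g t ^ 2 = 1)
    (hkK : ∀ t ∈ Set.Icc (0 : ℝ) L, Kmin ≤ |k t|) (hσ0 : 0 < σ) (hσ : σ < 1 / 4)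
    (hord : {t ∈ Set.Icc (0 : ℝ) L | |f t| < 2 * σ}.OrdConnected) :
    (volume {t ∈ Set.Icc (0 : ℝ) L | |f t| < 2 * σ}).toReal ≤ 8 * σ / Kmin := by
  have key : ∀ a ∈ {t ∈ Set.Icc (0 : ℝ) L | |f t| < 2 * σ},
      ∀ b ∈ {t ∈ Set.Icc (0 : ℝ) L | |f t| < 2 * σ}, a < b → b - a ≤ 8 * σ / Kmin := by
    intro a ha b hb hab
    have hsub := hord.out ha hb
    obtain ⟨c, hc, hslope⟩ := exists_hasDerivAt_eq_slope f (fun t => k t * g t) hab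
      (fun t ht => (hf t (hsub ht).1).continuousAt.continuousWithinAt)
      (fun t ht => hf t (hsub (Set.Ioo_subset_Icc_self ht)).1)
    obtain ⟨hcL, hfc⟩ := hsub (Set.Ioo_subset_Icc_self hc)
    have hgc : 1 / 2 ≤ |g c| := by
      have h1 := hfg c hcL
      have h2 := abs_lt.1 hfc
      rw [← abs_of_pos (one_half_pos (α := ℝ)), ← sq_le_sq]
      nlinarith
    have hkg : Kmin * (1 / 2) ≤ |k c * g c| := by
      rw [abs_mul]
      exact mul_le_mul (hkK c hcL) hgc (by norm_num) (abs_nonneg _)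
    have hba : 0 < b - a := sub_pos.2 hab
    have hdiff : |k c * g c| * (b - a) = |f b - f a| := by
      rw [hslope, abs_div, abs_of_pos hba, div_mul_cancel₀ _ hba.ne']
    have hle : |f b - f a| ≤ 4 * σ := by
      have h1 := abs_lt.1 ha.2
      have h2 := abs_lt.1 hb.2
      rw [abs_le]
      constructor <;> linarith
    rw [le_div_iff₀ hK]
    nlinarith [mul_le_mul_of_nonneg_right hkg hba.le]
  have hnn : 0 ≤ 8 * σ / Kmin := by positivity
  refine ENNReal.toReal_le_of_le_ofReal hnn ((Real.volume_le_diam _).trans ?_)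
  refine Metric.ediam_le fun a ha b hb => ?_
  rw [edist_dist]
  refine ENNReal.ofReal_le_ofReal ?_
  rw [Real.dist_eq, abs_le]
  rcases lt_trichotomy a b with h | h | h
  · have := key a ha b hb h
    constructor <;> linarith
  · subst h
    constructor <;> linarith
  · have := key b hb a ha h
    constructor <;> linarith

/-- Lemma 3.1: for a unit-speed curve with curvature pinched in `[Kmin, Kmax]` and total
curvature `< π/2`, for small `σ` the set `B_μ` where the derivative of the phase function
`φ_μ(t) = ⟨μ/|μ|, γ(t)⟩` is `< 2σ` in absolute value is an interval of length `≤ 8σ/Kmin`. -/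
theorem phase_near_stationary_set :
    ∃ σ0 > (0:ℝ), ∀ (L Kmin Kmax : ℝ) (γ : ℝ → ℝ × ℝ),
      0 < L → 0 < Kmin →
      ContDiff ℝ (⊤ : ℕ∞) γ →
      (∀ t ∈ Set.Icc (0:ℝ) L, e2 (deriv γ t) = 1) →
      (∀ t ∈ Set.Icc (0:ℝ) L,
        Kmin ≤ e2 (deriv (deriv γ) t) ∧ e2 (deriv (deriv γ) t) ≤ Kmax) →
      (∫ t in (0:ℝ)..L, e2 (deriv (deriv γ) t)) < π / 2 →
      ∀ σ : ℝ, 0 < σ → σ < σ0 →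
      ∀ μ : ℝ × ℝ, μ ≠ 0 →
        {t ∈ Set.Icc (0:ℝ) L |
            |(μ.1 * (deriv γ t).1 + μ.2 * (deriv γ t).2) / e2 μ| < 2 * σ}.OrdConnected ∧
        (volume {t ∈ Set.Icc (0:ℝ) L |
            |(μ.1 * (deriv γ t).1 + μ.2 * (deriv γ t).2) / e2 μ| < 2 * σ}).toReal
          ≤ 8 * σ / Kmin := by
  refine ⟨1 / 4, by norm_num, fun L Kmin Kmax γ hL hK hγ hunit hcurv htot σ hσ0 hσ μ hμ => ?_⟩
  have hγ1 : ContDiff ℝ (⊤ : ℕ∞) (deriv γ) := (contDiff_infty_iff_deriv.1 hγ).2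
  have hγ2 : ContDiff ℝ (⊤ : ℕ∞) (deriv (deriv γ)) := (contDiff_infty_iff_deriv.1 hγ1).2
  have hT (t : ℝ) : HasDerivAt (deriv γ) (deriv (deriv γ) t) t :=
    (contDiff_infty_iff_deriv.1 hγ1).1.differentiableAt.hasDerivAt
  have hx (t : ℝ) : HasDerivAt (fun t => (deriv γ t).1) (deriv (deriv γ) t).1 t :=
    (hasFDerivAt_fst (𝕜 := ℝ) (p := deriv γ t)).comp_hasDerivAt t (hT t)
  have hy (t : ℝ) : HasDerivAt (fun t => (deriv γ t).2) (deriv (deriv γ) t).2 t :=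
    (hasFDerivAt_snd (𝕜 := ℝ) (p := deriv γ t)).comp_hasDerivAt t (hT t)
  have hc1 := hγ1.continuous
  have hc2 := hγ2.continuous
  have hnorm : ∀ t ∈ Set.Icc (0 : ℝ) L, (deriv γ t).1 ^ 2 + (deriv γ t).2 ^ 2 = 1 :=
    fun t ht => Real.sqrt_eq_one.1 (hunit t ht)
  have horth : ∀ t ∈ Set.Icc (0 : ℝ) L,
      (deriv γ t).1 * (deriv (deriv γ) t).1 + (deriv γ t).2 * (deriv (deriv γ) t).2 = 0 := by
    intro t ht
    have h1 := (((hx t).pow 2).add ((hy t).pow 2)).hasDerivWithinAt (s := Set.Icc 0 L)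
    have h2 := (hasDerivWithinAt_const t (Set.Icc 0 L) (1 : ℝ)).congr hnorm (hnorm t ht)
    have h3 := (uniqueDiffOn_Icc hL t ht).eq_deriv _ h1 h2
    norm_num at h3
    linarith
  set k : ℝ → ℝ := fun t =>
    (deriv γ t).1 * (deriv (deriv γ) t).2 - (deriv γ t).2 * (deriv (deriv γ) t).1 with hk_def
  have hk : Continuous k := by fun_prop
  have hk1 : ∀ t ∈ Set.Icc (0 : ℝ) L, (deriv (deriv γ) t).1 = -(k t * (deriv γ t).2) := by
    intro t ht
    simp only [hk_def]
    linear_combination (-(deriv (deriv γ) t).1) * hnorm t ht + (deriv γ t).1 * horth t ht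
  have hk2 : ∀ t ∈ Set.Icc (0 : ℝ) L, (deriv (deriv γ) t).2 = k t * (deriv γ t).1 := by
    intro t ht
    simp only [hk_def]
    linear_combination (-(deriv (deriv γ) t).2) * hnorm t ht + (deriv γ t).2 * horth t ht
  have hcurv_eq : ∀ t ∈ Set.Icc (0 : ℝ) L, e2 (deriv (deriv γ) t) = |k t| := by
    intro t ht
    rw [e2, ← Real.sqrt_sq_eq_abs, hk1 t ht, hk2 t ht]
    congr 1
    linear_combination k t ^ 2 * hnorm t ht
  have htot' : ∫ t in (0 : ℝ)..L, |k t| < π / 2 := by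
    rwa [intervalIntegral.integral_congr (g := fun t => e2 (deriv (deriv γ) t)) fun t ht =>
      (hcurv_eq t (by rwa [Set.uIcc_of_le hL.le] at ht)).symm]
  have hkK : ∀ t ∈ Set.Icc (0 : ℝ) L, Kmin ≤ |k t| := fun t ht =>
    (hcurv t ht).1.trans_eq (hcurv_eq t ht)
  have hμ2 : 0 < μ.1 ^ 2 + μ.2 ^ 2 := by
    by_contra! h
    exact hμ (Prod.ext (pow_eq_zero_iff two_ne_zero |>.1 (by nlinarith))
      (pow_eq_zero_iff two_ne_zero |>.1 (by nlinarith)))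
  have hμe : e2 μ ≠ 0 := (Real.sqrt_pos.2 hμ2).ne'
  have hμsq : e2 μ ^ 2 = μ.1 ^ 2 + μ.2 ^ 2 := Real.sq_sqrt hμ2.le
  have hf : ∀ t ∈ Set.Icc (0 : ℝ) L,
      HasDerivAt (fun t => (μ.1 * (deriv γ t).1 + μ.2 * (deriv γ t).2) / e2 μ)
        (k t * ((μ.2 * (deriv γ t).1 - μ.1 * (deriv γ t).2) / e2 μ)) t := by
    intro t ht
    refine ((((hx t).const_mul μ.1).add ((hy t).const_mul μ.2)).div_const (e2 μ)).congr_deriv ?_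
    rw [hk1 t ht, hk2 t ht]
    ring
  have hg : ∀ t ∈ Set.Icc (0 : ℝ) L,
      HasDerivAt (fun t => (μ.2 * (deriv γ t).1 - μ.1 * (deriv γ t).2) / e2 μ)
        (-(k t * ((μ.1 * (deriv γ t).1 + μ.2 * (deriv γ t).2) / e2 μ))) t := by
    intro t ht
    refine ((((hx t).const_mul μ.2).sub ((hy t).const_mul μ.1)).div_const (e2 μ)).congr_deriv ?_
    rw [hk1 t ht, hk2 t ht]
    ring
  have hfg : ∀ t ∈ Set.Icc (0 : ℝ) L,
      ((μ.1 * (deriv γ t).1 + μ.2 * (deriv γ t).2) / e2 μ) ^ 2 +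
        ((μ.2 * (deriv γ t).1 - μ.1 * (deriv γ t).2) / e2 μ) ^ 2 = 1 := by
    intro t ht
    rw [div_pow, div_pow, ← add_div, div_eq_one_iff_eq (pow_ne_zero 2 hμe), hμsq]
    linear_combination (μ.1 ^ 2 + μ.2 ^ 2) * hnorm t ht
  have hord := ordConnected_of_rotating hL hK hk hf hg hfg htot' hkK hσ
  exact ⟨hord, volume_le_of_rotating hK hf hfg hkK hσ0 hσ hord⟩
end
end
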